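/- arXiv:1012.5863 — 10 statements merged into one kernel-verified Lean document; each statement's English description precedes it below -/
import Mathlib

section
/- Let X be a metric space, let A and B be nonempty compact subsets of X, let μ be a finite signed Borel measure on A, and let ε > d_H(A,B) where d_H denotes Hausdorff distance. Then there exists a finitely supported signed Borel measure ν on B such that ν(B) = μ(A), the total variation norm satisfies ‖ν‖ ≤ ‖μ‖, and for every uniformly continuous function f : X → ℝ one has |∫_A f dμ − ∫_B f dν| ≤ ‖μ‖ · ω_f(ε), where ω_f(ε) = sup{|f(x) − f(y)| : x,y ∈ X, d(x,y) < ε} is the modulus of continuity of f. Moreover, if μ is a positive measure then ν can be taken to be positive. -/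
open MeasureTheory Metric
open scoped ENNReal

/-- Integral of a real-valued function against a finite signed Borel measure. -/
noncomputable def sInt {A : Type*} [MeasurableSpace A] (μ : SignedMeasure A) (f : A → ℝ) : ℝ :=
  ∫ x, f x ∂μ.toJordanDecomposition.posPart - ∫ x, f x ∂μ.toJordanDecomposition.negPart

/-- The modulus of continuity `ω_f(ε) = sup {|f x - f y| : dist x y < ε}`,
valued in `ℝ≥0∞`. -/
noncomputable def modCont {X : Type*} [MetricSpace X] (f : X → ℝ) (ε : ℝ) : ℝ≥0∞ :=
  ⨆ (x : X) (y : X) (_ : dist x y < ε), ENNReal.ofReal |f x - f y|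

lemma posPart_le_aux {X : Type*} [MeasurableSpace X] (ν : SignedMeasure X) (P N : Measure X)
    [IsFiniteMeasure P] [IsFiniteMeasure N]
    (h : ∀ E, MeasurableSet E → ν E = P.real E - N.real E) :
    ν.toJordanDecomposition.posPart ≤ P := by
  obtain ⟨i, hi₁, hi₂, hi₃, hpos, hneg⟩ := ν.toJordanDecomposition_spec
  refine Measure.le_iff.2 fun E hE => ?_
  rw [hpos]
  rw [← ENNReal.toReal_le_toReal (measure_ne_top _ _) (measure_ne_top _ _)]
  change Measure.real _ _ ≤ Measure.real _ _
  rw [SignedMeasure.toMeasureOfZeroLE_real_apply _ hi₂ hi₁ hE, h _ (hi₁.inter hE)]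
  have h1 : P.real (i ∩ E) ≤ P.real E := measureReal_mono Set.inter_subset_right
  have h2 : 0 ≤ N.real (i ∩ E) := measureReal_nonneg
  linarith

lemma negPart_le_aux {X : Type*} [MeasurableSpace X] (ν : SignedMeasure X) (P N : Measure X)
    [IsFiniteMeasure P] [IsFiniteMeasure N]
    (h : ∀ E, MeasurableSet E → ν E = P.real E - N.real E) :
    ν.toJordanDecomposition.negPart ≤ N := by
  have := posPart_le_aux (-ν) N P (fun E hE => by
    rw [VectorMeasure.neg_apply, h E hE]; ring)
  rwa [SignedMeasure.toJordanDecomposition_neg, JordanDecomposition.neg_posPart] at this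

lemma sInt_aux {X : Type*} [MeasurableSpace X] (ν : SignedMeasure X) (P N : Measure X)
    [IsFiniteMeasure P] [IsFiniteMeasure N]
    (h : ∀ E, MeasurableSet E → ν E = P.real E - N.real E) (f : X → ℝ)
    (hP : Integrable f P) (hN : Integrable f N) :
    sInt ν f = ∫ x, f x ∂P - ∫ x, f x ∂N := by
  have hp := hP.mono_measure (posPart_le_aux ν P N h)
  have hn := hN.mono_measure (negPart_le_aux ν P N h)
  have key : P + ν.toJordanDecomposition.negPart = N + ν.toJordanDecomposition.posPart := by
    ext E hE
    rw [← ENNReal.toReal_eq_toReal_iff' (measure_ne_top _ _) (measure_ne_top _ _)]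
    change Measure.real _ _ = Measure.real _ _
    rw [measureReal_add_apply, measureReal_add_apply]
    have h1 := h E hE
    rw [ν.apply_eq_posPart_real_sub_negPart_real hE] at h1
    linarith
  have h2 := integral_add_measure hP hn
  rw [key, integral_add_measure hN hp] at h2
  unfold sInt
  linarith

lemma exists_T_aux {X : Type*} [MetricSpace X] [MeasurableSpace X] [BorelSpace X] (ε : ℝ)
    (b₀ : X) (s : Finset X) :
    ∃ T : X → X, Measurable T ∧ (∀ x, T x = b₀ ∨ T x ∈ s) ∧
      ∀ x, (∃ b ∈ s, dist x b < ε) → dist x (T x) < ε := by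
  classical
  induction s using Finset.induction_on with
  | empty => exact ⟨fun _ => b₀, measurable_const, by simp, by simp⟩
  | insert a s ha ih =>
    obtain ⟨T, hT, hr, hd⟩ := ih
    refine ⟨fun x => if x ∈ ball a ε then a else T x,
      Measurable.ite measurableSet_ball measurable_const hT, fun x => ?_, fun x hx => ?_⟩
    · by_cases h : x ∈ ball a ε
      · simp only [h, if_true]; simp
      · simp only [h, if_false]
        rcases hr x with h | h
        · exact Or.inl h
        · exact Or.inr (Finset.mem_insert_of_mem h)
    · by_cases h : x ∈ ball a ε
      · simp only [h, if_true]; exact h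
      · simp only [h, if_false]
        obtain ⟨b, hb, hxb⟩ := hx
        rcases Finset.mem_insert.1 hb with rfl | hb
        · exact absurd hxb h
        · exact hd x ⟨b, hb, hxb⟩

lemma integrable_aux {X : Type*} [MetricSpace X] [MeasurableSpace X] [BorelSpace X]
    {A : Set X} (hA : IsCompact A) (P : Measure X) [IsFiniteMeasure P] (hP : P Aᶜ = 0)
    (f : X → ℝ) (hf : Continuous f) : Integrable f P := by
  obtain ⟨C, hC⟩ := hA.exists_bound_of_continuousOn hf.continuousOn
  refine Integrable.of_bound (C := C) hf.measurable.aestronglyMeasurable ?_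
  filter_upwards [(mem_ae_iff.2 hP : A ∈ ae P)] with x hx using hC x hx

lemma diff_aux {X : Type*} [MetricSpace X] [MeasurableSpace X] [BorelSpace X]
    {A : Set X} (P : Measure X) [IsFiniteMeasure P] (hP : P Aᶜ = 0)
    (f : X → ℝ) (hf : Continuous f) (hfP : Integrable f P) (T : X → X) (hT : Measurable T)
    (hfT : Integrable f (P.map T)) (ε : ℝ) (hd : ∀ x ∈ A, dist x (T x) < ε) :
    ENNReal.ofReal |∫ x, f x ∂P - ∫ x, f x ∂(P.map T)| ≤ P Set.univ * modCont f ε := by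
  have hfT' : Integrable (fun x => f (T x)) P := hfT.comp_measurable hT
  rw [integral_map hT.aemeasurable hf.measurable.aestronglyMeasurable,
    ← integral_sub hfP hfT', ← Real.norm_eq_abs, ofReal_norm]
  refine (enorm_integral_le_lintegral_enorm _).trans ?_
  rw [mul_comm, ← lintegral_const]
  refine lintegral_mono_ae ?_
  filter_upwards [(mem_ae_iff.2 hP : A ∈ ae P)] with x hx
  rw [← ofReal_norm, Real.norm_eq_abs]
  exact le_iSup_of_le x (le_iSup_of_le (T x) (le_iSup_of_le (hd x hx) le_rfl))

theorem statement0 {X : Type*} [MetricSpace X] [MeasurableSpace X] [BorelSpace X]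
    (A B : Set X) (hA : IsCompact A) (hB : IsCompact B)
    (hAne : A.Nonempty) (hBne : B.Nonempty)
    (μ : SignedMeasure X) (hμA : μ.totalVariation Aᶜ = 0)
    (ε : ℝ) (hε : hausdorffDist A B < ε) :
    ∃ ν : SignedMeasure X,
      (∃ s : Finset X, ↑s ⊆ B ∧ ν.totalVariation (↑s : Set X)ᶜ = 0) ∧
      ν Set.univ = μ Set.univ ∧
      ν.totalVariation Set.univ ≤ μ.totalVariation Set.univ ∧
      (∀ f : X → ℝ, UniformContinuous f →
        ENNReal.ofReal |sInt μ f - sInt ν f| ≤ μ.totalVariation Set.univ * modCont f ε) ∧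
      (0 ≤ μ → 0 ≤ ν) := by
  classical
  obtain ⟨b₀, hb₀⟩ := hBne
  have hfin := hausdorffEDist_ne_top_of_nonempty_of_bounded hAne ⟨b₀, hb₀⟩
    hA.isBounded hB.isBounded
  have hcov : A ⊆ ⋃ b ∈ B, ball b ε := fun x hx => by
    obtain ⟨b, hb, hxb⟩ := exists_dist_lt_of_hausdorffDist_lt hx hε hfin
    exact Set.mem_biUnion hb hxb
  obtain ⟨t, htB, htfin, ht⟩ := hA.elim_finite_subcover_image (fun b _ => isOpen_ball) hcov
  obtain ⟨T, hT, hr, hd⟩ := exists_T_aux ε b₀ htfin.toFinset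
  have hdA : ∀ x ∈ A, dist x (T x) < ε := fun x hx => by
    obtain ⟨b, hb, hxb⟩ := Set.mem_iUnion₂.1 (ht hx)
    exact hd x ⟨b, htfin.mem_toFinset.2 hb, hxb⟩
  set P := μ.toJordanDecomposition.posPart with hPdef
  set N := μ.toJordanDecomposition.negPart with hNdef
  have hPN : P Aᶜ = 0 ∧ N Aᶜ = 0 := by
    rw [SignedMeasure.totalVariation, Measure.add_apply, add_eq_zero] at hμA
    exact hμA
  have hν : ∀ E, MeasurableSet E →
      μ.map T E = (P.map T).real E - (N.map T).real E := fun E hE => by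
    rw [VectorMeasure.map_apply _ hT hE, μ.apply_eq_posPart_real_sub_negPart_real (hT hE),
      map_measureReal_apply hT hE, map_measureReal_apply hT hE]
  have hp := posPart_le_aux _ _ _ hν
  have hn := negPart_le_aux _ _ _ hν
  set s : Finset X := insert b₀ htfin.toFinset with hs
  have hTs : T ⁻¹' (↑s : Set X)ᶜ = ∅ := by
    ext x
    have := hr x
    simp only [hs, Set.mem_preimage, Set.mem_compl_iff, Finset.mem_coe, Finset.mem_insert,
      Set.mem_empty_iff_false, iff_false, not_not]
    exact this
  have hms : MeasurableSet (↑s : Set X)ᶜ := s.measurableSet.compl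
  have hP0 : (P.map T) (↑s : Set X)ᶜ = 0 := by rw [Measure.map_apply hT hms, hTs, measure_empty]
  have hN0 : (N.map T) (↑s : Set X)ᶜ = 0 := by rw [Measure.map_apply hT hms, hTs, measure_empty]
  refine ⟨μ.map T, ⟨s, ?_, ?_⟩, ?_, ?_, ?_, ?_⟩
  · intro x hx
    rcases Finset.mem_insert.1 (Finset.mem_coe.1 hx) with rfl | hx
    · exact hb₀
    · exact htB (htfin.mem_toFinset.1 hx)
  · rw [SignedMeasure.totalVariation, Measure.add_apply, add_eq_zero]
    exact ⟨le_antisymm ((hp _).trans hP0.le) bot_le, le_antisymm ((hn _).trans hN0.le) bot_le⟩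
  · rw [VectorMeasure.map_apply _ hT MeasurableSet.univ, Set.preimage_univ]
  · rw [SignedMeasure.totalVariation, SignedMeasure.totalVariation, Measure.add_apply,
      Measure.add_apply]
    refine add_le_add ((hp _).trans ?_) ((hn _).trans ?_) <;>
      rw [Measure.map_apply hT MeasurableSet.univ, Set.preimage_univ]
  · intro f hf
    have hfc := hf.continuous
    have i1 := integrable_aux hA P hPN.1 f hfc
    have i2 := integrable_aux hA N hPN.2 f hfc
    have i3 := integrable_aux s.finite_toSet.isCompact _ hP0 f hfc
    have i4 := integrable_aux s.finite_toSet.isCompact _ hN0 f hfc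
    have d1 := diff_aux P hPN.1 f hfc i1 T hT i3 ε hdA
    have d2 := diff_aux N hPN.2 f hfc i2 T hT i4 ε hdA
    rw [sInt_aux _ _ _ hν f i3 i4, SignedMeasure.totalVariation, Measure.add_apply, add_mul]
    refine le_trans ?_ (add_le_add d1 d2)
    rw [← ENNReal.ofReal_add (abs_nonneg _) (abs_nonneg _)]
    refine ENNReal.ofReal_le_ofReal ?_
    unfold sInt
    rw [← hPdef, ← hNdef]
    refine le_trans (le_of_eq ?_) (abs_sub _ _)
    congr 1
    ring
  · intro h
    rw [VectorMeasure.le_iff] at h ⊢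
    intro E hE
    rw [VectorMeasure.map_apply _ hT hE]
    exact h _ (hT hE)
end

section
/- A compact metric space (A,d) is positive semidefinite if and only if the symmetric bilinear form Z_A(μ,ν) = ∫_A ∫_A e^{−d(x,y)} dμ(x) dν(y) on the space of finite signed Borel measures on A is positive semidefinite, i.e., Z_A(μ,μ) ≥ 0 for every finite signed Borel measure μ on A. -/
open MeasureTheory Metric
open scoped ENNReal

/-- The bilinear form `Z_A(μ,ν) = ∫∫ e^{-d(x,y)} dμ(x) dν(y)` on finite signed
Borel measures. -/
noncomputable def Zform {A : Type*} [MetricSpace A] [MeasurableSpace A]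
    (μ ν : SignedMeasure A) : ℝ :=
  sInt μ (fun x => sInt ν (fun y => Real.exp (-dist x y)))

/-- A metric space is positive semidefinite if every finite subspace has positive
semidefinite similarity matrix `[e^{-d(x,y)}]`. -/
def PosSemidefSpace (A : Type*) [MetricSpace A] : Prop :=
  ∀ s : Finset A, (Matrix.of fun x y : ↥s => Real.exp (-dist (x : A) (y : A))).PosSemidef

theorem integral_simple {A : Type*} [MeasurableSpace A] (p : Measure A) [IsFiniteMeasure p]
    (π : SimpleFunc A A) (g : A → ℝ) :
    ∫ x, g (π x) ∂p = ∑ a ∈ π.range, g a * p.real (π ⁻¹' {a}) := by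
  have h : ∀ x, g (π x) = ∑ a ∈ π.range, (π ⁻¹' {a}).indicator (fun _ => g a) x := by
    intro x
    rw [Finset.sum_eq_single (π x)]
    · simp
    · intro b _ hb
      exact Set.indicator_of_notMem (by simpa using hb.symm) _
    · intro hx
      exact absurd (SimpleFunc.mem_range_self π x) hx
  simp_rw [h]
  rw [integral_finsetSum]
  · refine Finset.sum_congr rfl fun a _ => ?_
    rw [integral_indicator_const _ (π.measurableSet_preimage _), smul_eq_mul, mul_comm]
  · intro a _
    exact (integrable_const _).indicator (π.measurableSet_preimage _)

theorem sInt_simple {A : Type*} [MeasurableSpace A] (μ : SignedMeasure A)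
    (π : SimpleFunc A A) (g : A → ℝ) :
    sInt μ (fun x => g (π x)) = ∑ a ∈ π.range, g a *
      (μ.toJordanDecomposition.posPart.real (π ⁻¹' {a})
        - μ.toJordanDecomposition.negPart.real (π ⁻¹' {a})) := by
  simp_rw [sInt, integral_simple, mul_sub, Finset.sum_sub_distrib]

theorem sInt_tendsto {A : Type*} [MeasurableSpace A] (μ : SignedMeasure A)
    {F : ℕ → A → ℝ} {f : A → ℝ} {C : ℝ} (hm : ∀ n, Measurable (F n))
    (hb : ∀ n x, |F n x| ≤ C)
    (hl : ∀ x, Filter.Tendsto (fun n => F n x) Filter.atTop (nhds (f x))) :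
    Filter.Tendsto (fun n => sInt μ (F n)) Filter.atTop (nhds (sInt μ f)) := by
  refine Filter.Tendsto.sub ?_ ?_ <;>
  exact tendsto_integral_of_dominated_convergence (fun _ => C)
      (fun n => (hm n).aestronglyMeasurable) (integrable_const _)
      (fun n => Filter.Eventually.of_forall (hb n)) (Filter.Eventually.of_forall hl)

theorem sInt_bound {A : Type*} [MeasurableSpace A] (μ : SignedMeasure A)
    {f : A → ℝ} (hb : ∀ x, |f x| ≤ 1) :
    |sInt μ f| ≤ μ.toJordanDecomposition.posPart.real Set.univ
          + μ.toJordanDecomposition.negPart.real Set.univ := by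
  have h : ∀ (p : Measure A) [IsFiniteMeasure p], |∫ x, f x ∂p| ≤ p.real Set.univ := by
    intro p _
    have := norm_integral_le_of_norm_le_const (μ := p) (f := f) (C := 1)
      (Filter.Eventually.of_forall hb)
    simpa using this
  exact (abs_sub _ _).trans (add_le_add (h _) (h _))

theorem sInt_eq {A : Type*} [MetricSpace A] [CompactSpace A]
    [MeasurableSpace A] [BorelSpace A] (p q : Measure A) [IsFiniteMeasure p] [IsFiniteMeasure q]
    (f : A → ℝ) (hf : Continuous f) :
    sInt (p.toSignedMeasure - q.toSignedMeasure) f = ∫ x, f x ∂p - ∫ x, f x ∂q := by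
  have hi : ∀ (m : Measure A) [IsFiniteMeasure m], Integrable f m := fun m _ =>
    hf.integrable_of_hasCompactSupport (HasCompactSupport.of_compactSpace f)
  set μ := p.toSignedMeasure - q.toSignedMeasure with hμ
  have h := μ.toSignedMeasure_toJordanDecomposition
  rw [JordanDecomposition.toSignedMeasure, hμ, sub_eq_sub_iff_add_eq_add, ← hμ,
    ← Measure.toSignedMeasure_add, ← Measure.toSignedMeasure_add,
    Measure.toSignedMeasure_eq_toSignedMeasure_iff] at h
  have h2 := congrArg (fun m => ∫ x, f x ∂m) h
  rw [integral_add_measure (hi _) (hi _), integral_add_measure (hi _) (hi _)] at h2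
  rw [sInt]
  linarith

theorem statement1 (A : Type*) [MetricSpace A] [CompactSpace A]
    [MeasurableSpace A] [BorelSpace A] :
    PosSemidefSpace A ↔ ∀ μ : SignedMeasure A, 0 ≤ Zform μ μ := by
  constructor
  · intro h μ
    rcases isEmpty_or_nonempty A with hA | ⟨⟨y₀⟩⟩
    · have h0 : ∀ m : Measure A, m = 0 := fun m => Measure.eq_zero_of_isEmpty m
      simp [Zform, sInt, h0 μ.toJordanDecomposition.posPart, h0 μ.toJordanDecomposition.negPart]
    let π : ℕ → SimpleFunc A A := fun n =>
      SimpleFunc.approxOn id measurable_id Set.univ y₀ (Set.mem_univ _) n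
    have hπ : ∀ x, Filter.Tendsto (fun n => π n x) Filter.atTop (nhds x) := fun x =>
      SimpleFunc.tendsto_approxOn measurable_id (Set.mem_univ _) (by simp)
    have hK : ∀ x y : A, |Real.exp (-dist x y)| ≤ 1 := fun x y => by
      rw [abs_of_pos (Real.exp_pos _), Real.exp_le_one_iff]
      linarith [dist_nonneg (x := x) (y := y)]
    have key : Filter.Tendsto (fun n => sInt μ (fun x => sInt μ
        (fun y => Real.exp (-dist (π n x) (π n y))))) Filter.atTop (nhds (Zform μ μ)) := by
      refine sInt_tendsto μ
        (C := μ.toJordanDecomposition.posPart.real Set.univ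
          + μ.toJordanDecomposition.negPart.real Set.univ)
        (fun n => ((π n).map
          (fun a => sInt μ (fun y => Real.exp (-dist a (π n y))))).measurable)
        (fun n x => sInt_bound μ (fun y => hK _ _)) (fun x => ?_)
      refine sInt_tendsto μ (C := 1)
        (fun n => ((π n).map (fun b => Real.exp (-dist (π n x) b))).measurable)
        (fun n y => hK _ _) (fun y => ?_)
      exact (Real.continuous_exp.tendsto _).comp (((hπ x).dist (hπ y)).neg)
    refine ge_of_tendsto' key fun n => ?_
    have h1 : ∀ a, sInt μ (fun y => Real.exp (-dist a (π n y))) = _ := fun a =>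
      sInt_simple μ (π n) (fun b => Real.exp (-dist a b))
    simp_rw [h1]
    rw [sInt_simple μ (π n) (fun a => ∑ b ∈ (π n).range, Real.exp (-dist a b) *
      (μ.toJordanDecomposition.posPart.real (π n ⁻¹' {b})
        - μ.toJordanDecomposition.negPart.real (π n ⁻¹' {b})))]
    have h2 := (h (π n).range).dotProduct_mulVec_nonneg
      (fun a => μ.toJordanDecomposition.posPart.real (π n ⁻¹' {(a : A)})
        - μ.toJordanDecomposition.negPart.real (π n ⁻¹' {(a : A)}))
    simp only [dotProduct, Matrix.mulVec, Matrix.of_apply, Pi.star_apply, star_trivial] at h2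
    rw [← Finset.sum_coe_sort]
    simp_rw [← Finset.sum_coe_sort (π n).range (fun b => Real.exp (-dist _ b) * _)]
    simpa only [mul_comm] using h2
  · intro h s
    refine .of_dotProduct_mulVec_nonneg ?_ fun c => ?_
    · ext x y
      simp [dist_comm]
    let p : Measure A := ∑ i : s, ENNReal.ofReal (c i) • Measure.dirac (i : A)
    let q : Measure A := ∑ i : s, ENNReal.ofReal (-c i) • Measure.dirac (i : A)
    have hp : IsFiniteMeasure p := ⟨by simp [p]⟩
    have hq : IsFiniteMeasure q := ⟨by simp [q]⟩
    have hI : ∀ f : A → ℝ, Continuous f →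
        sInt (p.toSignedMeasure - q.toSignedMeasure) f = ∑ i : s, c i * f i := by
      intro f hf
      rw [sInt_eq p q f hf, integral_finsetSum_measure, integral_finsetSum_measure,
        ← Finset.sum_sub_distrib]
      · refine Finset.sum_congr rfl fun i _ => ?_
        rw [integral_smul_measure, integral_smul_measure, integral_dirac,
          ENNReal.toReal_ofReal', ENNReal.toReal_ofReal', smul_eq_mul, smul_eq_mul, ← sub_mul]
        congr 1
        rcases le_total 0 (c i) with h0 | h0
        · rw [max_eq_left h0, max_eq_right (by linarith)]; ring
        · rw [max_eq_right h0, max_eq_left (by linarith)]; ring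
      all_goals
        intro i _
        exact Integrable.smul_measure (integrable_dirac (by simp)) (by simp)
    have hZ := h (p.toSignedMeasure - q.toSignedMeasure)
    rw [Zform] at hZ
    have h1 : ∀ x : A, sInt (p.toSignedMeasure - q.toSignedMeasure)
        (fun y => Real.exp (-dist x y)) = _ := fun x => hI _ (by fun_prop)
    simp_rw [h1] at hZ
    rw [hI _ (by fun_prop)] at hZ
    simp only [dotProduct, Matrix.mulVec, Matrix.of_apply, Pi.star_apply, star_trivial]
    simpa only [mul_comm] using hZ
end

section
/- Let (A,d) be a compact positive definite metric space. Then |A| = sup{ μ(A)² / Z_A(μ,μ) : μ a nonzero finitely supported signed Borel measure on A }; that is, the supremum defining the magnitude over all finite signed Borel measures with Z_A(μ,μ) ≠ 0 is unchanged if it is restricted to nonzero finitely supported signed measures. -/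
open MeasureTheory Metric
open scoped ENNReal

/-- A metric space is positive definite if every finite subspace has positive
definite similarity matrix `[e^{-d(x,y)}]`. -/
def PosDefSpace (A : Type*) [MetricSpace A] : Prop :=
  ∀ s : Finset A, (Matrix.of fun x y : ↥s => Real.exp (-dist (x : A) (y : A))).PosDef

/-- The magnitude of a compact positive definite metric space, valued in `[0,∞]`. -/
noncomputable def magnitude (A : Type*) [MetricSpace A] [MeasurableSpace A] : ℝ≥0∞ :=
  ⨆ (μ : SignedMeasure A) (_ : Zform μ μ ≠ 0),
    ENNReal.ofReal ((μ Set.univ) ^ 2 / Zform μ μ)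

/-- A signed measure is finitely supported if its total variation vanishes outside
some finite set. -/
def FinSupp {A : Type*} [MeasurableSpace A] (μ : SignedMeasure A) : Prop :=
  ∃ s : Finset A, μ.totalVariation (↑s : Set A)ᶜ = 0


open Filter Topology

lemma aux_integrable {A : Type*} [MeasurableSpace A] (α : Measure A) [IsFiniteMeasure α]
    {g : A → ℝ} (hg : Measurable g) {C : ℝ} (hC : ∀ x, |g x| ≤ C) : Integrable g α :=
  Integrable.of_bound hg.aestronglyMeasurable C (Eventually.of_forall hC)

lemma aux_sInt_eq {A : Type*} [MeasurableSpace A] (μ : SignedMeasure A) (α β : Measure A)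
    [IsFiniteMeasure α] [IsFiniteMeasure β]
    (h : ∀ s, MeasurableSet s → μ s = α.real s - β.real s)
    {g : A → ℝ} (hg : Measurable g) {C : ℝ} (hC : ∀ x, |g x| ≤ C) :
    sInt μ g = ∫ x, g x ∂α - ∫ x, g x ∂β := by
  have e : α + μ.toJordanDecomposition.negPart = β + μ.toJordanDecomposition.posPart := by
    ext s hs
    have h1 := h s hs
    rw [μ.apply_eq_posPart_real_sub_negPart_real hs] at h1
    have h2 : (α + μ.toJordanDecomposition.negPart).real s
        = (β + μ.toJordanDecomposition.posPart).real s := by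
      rw [measureReal_add_apply, measureReal_add_apply]
      linarith
    exact (measureReal_eq_measureReal_iff).1 h2
  have e2 : ∫ x, g x ∂(α + μ.toJordanDecomposition.negPart)
      = ∫ x, g x ∂(β + μ.toJordanDecomposition.posPart) := by rw [e]
  rw [integral_add_measure (aux_integrable _ hg hC) (aux_integrable _ hg hC),
    integral_add_measure (aux_integrable _ hg hC) (aux_integrable _ hg hC)] at e2
  unfold sInt
  linarith

lemma aux_sInt_map {A : Type*} [MeasurableSpace A] (μ : SignedMeasure A) {f : A → A}
    (hf : Measurable f) {g : A → ℝ} (hg : Measurable g) {C : ℝ} (hC : ∀ x, |g x| ≤ C) :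
    sInt (μ.map f) g = sInt μ (fun x => g (f x)) := by
  rw [aux_sInt_eq (μ.map f) (μ.toJordanDecomposition.posPart.map f)
    (μ.toJordanDecomposition.negPart.map f) _ hg hC]
  · rw [integral_map hf.aemeasurable hg.aestronglyMeasurable,
      integral_map hf.aemeasurable hg.aestronglyMeasurable]
    rfl
  · intro s hs
    rw [VectorMeasure.map_apply _ hf hs, map_measureReal_apply hf hs,
      map_measureReal_apply hf hs, μ.apply_eq_posPart_real_sub_negPart_real (hf hs)]

lemma aux_sInt_bound {A : Type*} [MeasurableSpace A] (μ : SignedMeasure A)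
    {g : A → ℝ} {C : ℝ} (hC : ∀ x, |g x| ≤ C) :
    |sInt μ g| ≤ C * μ.toJordanDecomposition.posPart.real Set.univ
      + C * μ.toJordanDecomposition.negPart.real Set.univ := by
  unfold sInt
  refine (abs_sub _ _).trans (add_le_add ?_ ?_)
  · exact norm_integral_le_of_norm_le_const (f := g) (Eventually.of_forall fun x => hC x)
  · exact norm_integral_le_of_norm_le_const (f := g) (Eventually.of_forall fun x => hC x)

lemma aux_sInt_tendsto {A : Type*} [MeasurableSpace A] (μ : SignedMeasure A)
    {G : ℕ → A → ℝ} {g : A → ℝ} (hG : ∀ n, Measurable (G n)) {C : ℝ} (hC : ∀ n x, |G n x| ≤ C)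
    (h : ∀ x, Tendsto (fun n => G n x) atTop (𝓝 (g x))) :
    Tendsto (fun n => sInt μ (G n)) atTop (𝓝 (sInt μ g)) := by
  unfold sInt
  refine Tendsto.sub ?_ ?_
  · exact tendsto_integral_of_dominated_convergence (fun _ => C)
      (fun n => (hG n).aestronglyMeasurable) (integrable_const C)
      (fun n => Eventually.of_forall (hC n)) (Eventually.of_forall h)
  · exact tendsto_integral_of_dominated_convergence (fun _ => C)
      (fun n => (hG n).aestronglyMeasurable) (integrable_const C)
      (fun n => Eventually.of_forall (hC n)) (Eventually.of_forall h)

lemma aux_exp_bound {A : Type*} [MetricSpace A] (x y : A) : |Real.exp (-dist x y)| ≤ 1 := by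
  rw [abs_of_pos (Real.exp_pos _), Real.exp_le_one_iff]
  simp

lemma aux_continuous {A : Type*} [MetricSpace A] [MeasurableSpace A] [BorelSpace A]
    (ν : SignedMeasure A) : Continuous (fun x => sInt ν (fun y => Real.exp (-dist x y))) := by
  rw [continuous_iff_seqContinuous]
  intro u x hu
  refine aux_sInt_tendsto ν (C := 1) (fun n => ?_) (fun n y => aux_exp_bound _ _) (fun y => ?_)
  · exact (by fun_prop : Continuous fun y => Real.exp (-dist (u n) y)).measurable
  · exact ((by fun_prop : Continuous fun z => Real.exp (-dist z y)).tendsto x).comp hu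

lemma aux_Z_map {A : Type*} [MetricSpace A] [MeasurableSpace A] [BorelSpace A]
    (μ : SignedMeasure A) {f : A → A} (hf : Measurable f) :
    Zform (μ.map f) (μ.map f) =
      sInt μ (fun x => sInt μ (fun y => Real.exp (-dist (f x) (f y)))) := by
  unfold Zform
  rw [aux_sInt_map μ hf (aux_continuous (μ.map f)).measurable
    (fun x => aux_sInt_bound (μ.map f) (aux_exp_bound x))]
  congr 1
  funext x
  exact aux_sInt_map μ hf
    (by fun_prop : Continuous fun y => Real.exp (-dist (f x) y)).measurable (aux_exp_bound (f x))

lemma aux_finSupp_map {A : Type*} [MetricSpace A] [MeasurableSpace A] [BorelSpace A]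
    (μ : SignedMeasure A) (f : SimpleFunc A A) : FinSupp (μ.map f) := by
  refine ⟨f.range, ?_⟩
  have hS : MeasurableSet ((f.range : Set A)ᶜ) := f.range.measurableSet.compl
  obtain ⟨i, hi₁, hi₂, hi₃, hpos, hneg⟩ :=
    SignedMeasure.toJordanDecomposition_spec (μ.map f)
  have key : ∀ T, MeasurableSet T → T ⊆ (f.range : Set A)ᶜ → (μ.map f) T = 0 := by
    intro T hT hTs
    rw [VectorMeasure.map_apply _ f.measurable hT]
    have : f ⁻¹' T = ∅ := by
      ext x
      simp only [Set.mem_preimage, Set.mem_empty_iff_false, iff_false]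
      intro hx
      exact hTs hx (by simp)
    rw [this, VectorMeasure.empty]
  rw [SignedMeasure.totalVariation, Measure.add_apply, hpos, hneg,
    SignedMeasure.toMeasureOfZeroLE_apply _ _ _ hS, SignedMeasure.toMeasureOfLEZero_apply _ _ _ hS]
  have k1 := key _ (hi₁.inter hS) Set.inter_subset_right
  have k2 := key _ (hi₁.compl.inter hS) Set.inter_subset_right
  rw [add_eq_zero]
  constructor
  · rw [ENNReal.coe_eq_zero]
    exact NNReal.eq k1
  · rw [ENNReal.coe_eq_zero]
    refine NNReal.eq ?_
    change -(μ.map f) _ = 0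
    rw [k2, neg_zero]

lemma aux_integral_fin {A : Type*} [MeasurableSpace A] [MeasurableSingletonClass A]
    (α : Measure A) [IsFiniteMeasure α] (s : Finset A) (h : α (s : Set A)ᶜ = 0) (g : A → ℝ) :
    ∫ x, g x ∂α = ∑ x ∈ s, α.real {x} * g x := by
  have : α = α.restrict (s : Set A) := (Measure.restrict_eq_self_of_ae_mem
    (by rwa [ae_iff])).symm
  conv_lhs => rw [this]
  rw [setIntegral_finset s IntegrableOn.finset]
  rfl

lemma aux_sInt_fin {A : Type*} [MeasurableSpace A] [MeasurableSingletonClass A]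
    (μ : SignedMeasure A) (s : Finset A) (h : μ.totalVariation (s : Set A)ᶜ = 0) (g : A → ℝ) :
    sInt μ g = ∑ x ∈ s, μ {x} * g x := by
  rw [SignedMeasure.totalVariation, Measure.add_apply, add_eq_zero] at h
  unfold sInt
  rw [aux_integral_fin _ s h.1, aux_integral_fin _ s h.2, ← Finset.sum_sub_distrib]
  refine Finset.sum_congr rfl fun x _ => ?_
  rw [μ.apply_eq_posPart_real_sub_negPart_real (measurableSet_singleton x)]
  ring

lemma aux_pos {A : Type*} [MetricSpace A] [MeasurableSpace A] [BorelSpace A]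
    (hA : PosDefSpace A) (μ : SignedMeasure A) (hf : FinSupp μ) (h0 : μ ≠ 0) :
    0 < Zform μ μ := by
  obtain ⟨s, hs⟩ := hf
  have hx : (fun x : s => μ {(x : A)}) ≠ 0 := by
    intro hc
    apply h0
    ext i hi
    have h1 : sInt μ (i.indicator 1) = μ i := by
      unfold sInt
      rw [integral_indicator_one hi, integral_indicator_one hi,
        μ.apply_eq_posPart_real_sub_negPart_real hi]
    rw [← h1, aux_sInt_fin μ s hs]
    change _ = (0 : ℝ)
    refine Finset.sum_eq_zero fun x hx => ?_
    have := congrFun hc ⟨x, hx⟩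
    simp only [Pi.zero_apply] at this
    rw [this, zero_mul]
  have := (hA s).dotProduct_mulVec_pos hx
  refine this.trans_eq (Eq.symm ?_)
  unfold Zform
  rw [aux_sInt_fin μ s hs, ← Finset.sum_coe_sort s]
  simp only [dotProduct, Matrix.mulVec, Matrix.of_apply, Pi.star_apply, star_trivial]
  refine Finset.sum_congr rfl fun x _ => ?_
  rw [aux_sInt_fin μ s hs, ← Finset.sum_coe_sort s]
  congr 1
  exact Finset.sum_congr rfl fun y _ => mul_comm _ _

theorem statement4 (A : Type*) [MetricSpace A] [CompactSpace A]
    [MeasurableSpace A] [BorelSpace A] (hA : PosDefSpace A) :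
    magnitude A =
      ⨆ (μ : SignedMeasure A) (_ : FinSupp μ ∧ μ ≠ 0),
        ENNReal.ofReal ((μ Set.univ) ^ 2 / Zform μ μ) := by
  unfold magnitude
  apply le_antisymm
  · refine iSup₂_le fun μ hμ => ?_
    by_cases hm : μ Set.univ = 0
    · simp [hm]
    have hne : Nonempty A := by
      by_contra hc
      rw [not_nonempty_iff] at hc
      rw [Set.univ_eq_empty_iff.2 hc, VectorMeasure.empty] at hm
      exact hm rfl
    obtain ⟨y₀⟩ := hne
    let f : ℕ → SimpleFunc A A := fun n =>
      SimpleFunc.approxOn (fun x : A => x) measurable_id Set.univ y₀ (Set.mem_univ _) n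
    have hf : ∀ x, Tendsto (fun n => f n x) atTop (𝓝 x) := fun x =>
      SimpleFunc.tendsto_approxOn (f := fun x : A => x) measurable_id (Set.mem_univ y₀) (by simp)
    have hin : ∀ x, Tendsto (fun n => sInt μ (fun y => Real.exp (-dist (f n x) (f n y)))) atTop
        (𝓝 (sInt μ (fun y => Real.exp (-dist x y)))) := by
      intro x
      refine aux_sInt_tendsto μ (C := 1) (fun n => ?_) (fun n y => aux_exp_bound _ _) (fun y => ?_)
      · exact (by fun_prop : Continuous fun y => Real.exp (-dist (f n x) y)).measurable.comp
          (f n).measurable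
      · exact (Real.continuous_exp.tendsto _).comp ((hf x).dist (hf y)).neg
    have hZ : Tendsto (fun n => Zform (μ.map (f n)) (μ.map (f n))) atTop (𝓝 (Zform μ μ)) := by
      simp_rw [fun n => aux_Z_map μ (f n).measurable]
      refine aux_sInt_tendsto μ (fun n => ?_)
        (fun n x => aux_sInt_bound μ (C := 1) (fun y => aux_exp_bound (f n x) (f n y))) hin
      exact ((f n).map (fun z => sInt μ (fun y => Real.exp (-dist z (f n y))))).measurable
    have huniv : ∀ n, (μ.map (f n)) Set.univ = μ Set.univ := fun n => by
      rw [VectorMeasure.map_apply _ (f n).measurable MeasurableSet.univ, Set.preimage_univ]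
    have hlim := ENNReal.tendsto_ofReal
      ((tendsto_const_nhds (x := (μ Set.univ) ^ 2)).div hZ hμ)
    refine le_of_tendsto' hlim fun n => ?_
    refine le_iSup₂_of_le (μ.map (f n)) ⟨aux_finSupp_map μ (f n), ?_⟩ ?_
    · intro hc
      apply hm
      rw [← huniv n, hc]
      rfl
    · rw [huniv]
      exact le_rfl
  · refine iSup₂_le fun μ hμ => ?_
    exact le_iSup₂_of_le μ (aux_pos hA μ hμ.1 hμ.2).ne' le_rfl
end

section
/- Let (A,d) be a compact positive definite metric space. Then the maximum diversity satisfies |A|₊ = sup{ μ(A)² / Z_A(μ,μ) : μ a nonzero finitely supported positive Borel measure on A }; that is, the supremum defining |A|₊ over all nonzero finite positive Borel measures is unchanged if it is restricted to nonzero finitely supported positive measures. -/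
open MeasureTheory Metric
open scoped ENNReal

/-- The bilinear form `Z_A` on positive measures. -/
noncomputable def Zm {A : Type*} [MetricSpace A] [MeasurableSpace A] (μ ν : Measure A) : ℝ :=
  ∫ x, ∫ y, Real.exp (-dist x y) ∂ν ∂μ

/-- The maximum diversity of a compact positive definite metric space,
valued in `[0,∞]`. -/
noncomputable def maxDivE (A : Type*) [MetricSpace A] [MeasurableSpace A] : ℝ≥0∞ :=
  ⨆ (μ : Measure A) (_ : IsFiniteMeasure μ ∧ μ ≠ 0),
    ENNReal.ofReal ((μ Set.univ).toReal ^ 2 / Zm μ μ)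

open Filter Topology

theorem statement5 (A : Type*) [MetricSpace A] [CompactSpace A]
    [MeasurableSpace A] [BorelSpace A] (hA : PosDefSpace A) :
    maxDivE A =
      ⨆ (μ : Measure A)
        (_ : (IsFiniteMeasure μ ∧ ∃ s : Finset A, μ (↑s : Set A)ᶜ = 0) ∧ μ ≠ 0),
        ENNReal.ofReal ((μ Set.univ).toReal ^ 2 / Zm μ μ) := by
  apply le_antisymm
  · refine iSup₂_le fun μ hμ => ?_
    obtain ⟨hfin, hne⟩ := hμ
    by_cases hZ : Zm μ μ = 0
    · simp [hZ]
    have : Nonempty A := by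
      by_contra h
      rw [not_nonempty_iff] at h
      exact hne (Measure.eq_zero_of_isEmpty μ)
    obtain ⟨y0⟩ := this
    let f : ℕ → SimpleFunc A A := fun n =>
      SimpleFunc.approxOn id measurable_id Set.univ y0 (Set.mem_univ _) n
    have hf : ∀ x, Tendsto (fun n => f n x) atTop (𝓝 x) := fun x =>
      SimpleFunc.tendsto_approxOn measurable_id (Set.mem_univ y0) (by simp)
    have hbd : ∀ x y : A, ‖Real.exp (-dist x y)‖ ≤ 1 := fun x y => by
      rw [Real.norm_eq_abs, Real.abs_exp]
      exact Real.exp_le_one_iff.mpr (neg_nonpos.mpr dist_nonneg)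
    have hmeas : ∀ (ν : Measure A) [IsFiniteMeasure ν],
        StronglyMeasurable (fun x => ∫ y, Real.exp (-dist x y) ∂ν) := by
      intro ν _
      apply StronglyMeasurable.integral_prod_right (f := fun x y : A => Real.exp (-dist x y))
      apply Continuous.stronglyMeasurable
      simp only [Function.uncurry_def]
      fun_prop
    have hZn : ∀ n, Zm (μ.map (f n)) (μ.map (f n)) =
        ∫ x, ∫ y, Real.exp (-dist (f n x) (f n y)) ∂μ ∂μ := by
      intro n
      have hm : AEMeasurable (f n) μ := (f n).measurable.aemeasurable
      unfold Zm
      rw [integral_map hm (hmeas _).aestronglyMeasurable]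
      congr 1
      ext x
      rw [integral_map hm]
      apply Continuous.aestronglyMeasurable
      fun_prop
    have hlim : Tendsto (fun n => Zm (μ.map (f n)) (μ.map (f n))) atTop (𝓝 (Zm μ μ)) := by
      simp only [hZn]
      unfold Zm
      refine tendsto_integral_of_dominated_convergence (fun _ => 1 * μ.real Set.univ) ?_
        (integrable_const _) ?_ ?_
      · intro n
        exact ((f n).map (fun z => ∫ y, Real.exp (-dist z (f n y)) ∂μ)).aestronglyMeasurable
      · intro n
        exact ae_of_all _ fun x => norm_integral_le_of_norm_le_const (ae_of_all _ fun y => hbd _ _)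
      · refine ae_of_all _ fun x => ?_
        refine tendsto_integral_of_dominated_convergence (fun _ => 1) ?_ (integrable_const _) ?_ ?_
        · intro n
          exact ((f n).map (fun z => Real.exp (-dist (f n x) z))).aestronglyMeasurable
        · intro n
          exact ae_of_all _ fun y => hbd _ _
        · exact ae_of_all _ fun y => (Real.continuous_exp.tendsto _).comp ((hf x).dist (hf y)).neg
    have hmass : ∀ n, μ.map (f n) Set.univ = μ Set.univ := fun n => by
      rw [Measure.map_apply (f n).measurable MeasurableSet.univ, Set.preimage_univ]
    have hlim2 : Tendsto (fun n => ENNReal.ofReal ((μ.map (f n) Set.univ).toReal ^ 2 /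
        Zm (μ.map (f n)) (μ.map (f n)))) atTop
        (𝓝 (ENNReal.ofReal ((μ Set.univ).toReal ^ 2 / Zm μ μ))) := by
      simp only [hmass]
      exact ENNReal.tendsto_ofReal (tendsto_const_nhds.div hlim hZ)
    refine le_of_tendsto' hlim2 fun n => ?_
    refine le_iSup₂_of_le (μ.map (f n)) ⟨⟨inferInstance, (f n).range, ?_⟩, ?_⟩ le_rfl
    · rw [Measure.map_apply (f n).measurable (Finset.measurableSet _).compl]
      convert measure_empty (μ := μ)
      ext x
      simp
    · intro h
      apply hne
      rw [← Measure.measure_univ_eq_zero, ← hmass n, h]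
      simp
  · refine iSup₂_le fun μ hμ => ?_
    exact le_iSup₂_of_le (f := fun (μ : Measure A) (_ : IsFiniteMeasure μ ∧ μ ≠ 0) =>
      ENNReal.ofReal ((μ Set.univ).toReal ^ 2 / Zm μ μ)) μ ⟨hμ.1.1, hμ.2⟩ le_rfl
end

section
/- Magnitude is lower semicontinuous with respect to the Gromov–Hausdorff distance on the class of nonempty compact positive definite metric spaces: for every nonempty compact positive definite metric space A and every real number r with r < |A| (where |A| takes values in [1,∞]), there exists δ > 0 such that every nonempty compact positive definite metric space B with Gromov–Hausdorff distance d_GH(A,B) < δ satisfies |B| > r. -/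
open MeasureTheory Metric
open scoped ENNReal

lemma sInt_sub_aux {A : Type*} [MeasurableSpace A] (p q : Measure A) [IsFiniteMeasure p]
    [IsFiniteMeasure q] (f : A → ℝ) (hf : Measurable f) (C : ℝ) (hC : ∀ x, |f x| ≤ C) :
    sInt (p.toSignedMeasure - q.toSignedMeasure) f = ∫ x, f x ∂p - ∫ x, f x ∂q := by
  have hintegrF : ∀ m : Measure A, IsFiniteMeasure m → Integrable f m := fun m _ =>
    Integrable.of_bound hf.aestronglyMeasurable C (Filter.Eventually.of_forall hC)
  unfold sInt
  set μ := p.toSignedMeasure - q.toSignedMeasure with hμ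
  set P := μ.toJordanDecomposition.posPart
  set N := μ.toJordanDecomposition.negPart
  have h1 : P.toSignedMeasure - N.toSignedMeasure = μ :=
    μ.toSignedMeasure_toJordanDecomposition
  have h2 : P + q = p + N := by
    rw [← Measure.toSignedMeasure_eq_toSignedMeasure_iff, Measure.toSignedMeasure_add,
      Measure.toSignedMeasure_add]
    exact sub_eq_sub_iff_add_eq_add.1 (h1.trans hμ)
  have h3 : ∫ x, f x ∂(P + q) = ∫ x, f x ∂(p + N) := by rw [h2]
  rw [integral_add_measure (hintegrF _ inferInstance) (hintegrF _ inferInstance),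
    integral_add_measure (hintegrF _ inferInstance) (hintegrF _ inferInstance)] at h3
  linarith

lemma exp_neg_lip {a b : ℝ} (ha : 0 ≤ a) (hb : 0 ≤ b) :
    |Real.exp (-a) - Real.exp (-b)| ≤ |a - b| := by
  wlog h : a ≤ b generalizing a b
  · rw [abs_sub_comm, abs_sub_comm a b]; exact this hb ha (le_of_not_ge h)
  have h1 : Real.exp (-b) ≤ Real.exp (-a) := Real.exp_le_exp.2 (by linarith)
  rw [abs_of_nonneg (by linarith), abs_of_nonpos (by linarith)]
  have h2 : Real.exp (-b) = Real.exp (-a) * Real.exp (-(b - a)) := by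
    rw [← Real.exp_add]; ring_nf
  have h3 := Real.add_one_le_exp (-(b - a))
  have h4 : Real.exp (-a) ≤ 1 := Real.exp_le_one_iff.2 (by linarith)
  have h5 := Real.exp_pos (-a)
  rw [h2]
  nlinarith

/-- Double difference integral of a kernel. -/
noncomputable def dInt {A : Type*} [MeasurableSpace A] (P N : Measure A) (f : A → ℝ) : ℝ :=
  ∫ x, f x ∂P - ∫ x, f x ∂N

lemma dInt_close {A : Type*} [MeasurableSpace A] (P N : Measure A) [IsFiniteMeasure P]
    [IsFiniteMeasure N] (f g : A → ℝ) (hf : Measurable f) (hg : Measurable g) (C : ℝ)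
    (hfC : ∀ x, |f x| ≤ C) (hgC : ∀ x, |g x| ≤ C) (ε : ℝ) (h : ∀ x, |f x - g x| ≤ ε) :
    |dInt P N f - dInt P N g| ≤ ε * (P.real Set.univ + N.real Set.univ) := by
  have hintegrF : ∀ m : Measure A, IsFiniteMeasure m → Integrable f m := fun m _ =>
    Integrable.of_bound hf.aestronglyMeasurable C (Filter.Eventually.of_forall hfC)
  have hintegrG : ∀ m : Measure A, IsFiniteMeasure m → Integrable g m := fun m _ =>
    Integrable.of_bound hg.aestronglyMeasurable C (Filter.Eventually.of_forall hgC)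
  have key : ∀ m : Measure A, IsFiniteMeasure m →
      |∫ x, f x ∂m - ∫ x, g x ∂m| ≤ ε * m.real Set.univ := by
    intro m hm
    rw [← integral_sub (hintegrF m hm) (hintegrG m hm)]
    exact norm_integral_le_of_norm_le_const (f := fun x => f x - g x)
      (Filter.Eventually.of_forall h)
  have hP := key P inferInstance
  have hN := key N inferInstance
  unfold dInt
  rw [abs_le] at *
  constructor <;> nlinarith [hP.1, hP.2, hN.1, hN.2]

lemma dInt_bound {A : Type*} [MeasurableSpace A] (P N : Measure A) [IsFiniteMeasure P]
    [IsFiniteMeasure N] (f : A → ℝ) (C : ℝ) (hfC : ∀ x, |f x| ≤ C) :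
    |dInt P N f| ≤ C * (P.real Set.univ + N.real Set.univ) := by
  have key : ∀ m : Measure A, IsFiniteMeasure m → |∫ x, f x ∂m| ≤ C * m.real Set.univ := by
    intro m hm
    exact norm_integral_le_of_norm_le_const (f := f) (Filter.Eventually.of_forall hfC)
  have hP := key P inferInstance
  have hN := key N inferInstance
  unfold dInt
  rw [abs_le] at *
  constructor <;> nlinarith [hP.1, hP.2, hN.1, hN.2]

lemma dInt_meas {X A : Type*} [MeasurableSpace X] [MeasurableSpace A] (P N : Measure A)
    [IsFiniteMeasure P] [IsFiniteMeasure N] (k : X → A → ℝ)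
    (hk : Measurable (Function.uncurry k)) : Measurable fun x => dInt P N (k x) := by
  unfold dInt
  exact (hk.stronglyMeasurable.integral_prod_right).measurable.sub
    (hk.stronglyMeasurable.integral_prod_right).measurable

lemma dInt2_close {A : Type*} [MeasurableSpace A] (P N : Measure A) [IsFiniteMeasure P]
    [IsFiniteMeasure N] (k l : A → A → ℝ) (hk : Measurable (Function.uncurry k))
    (hl : Measurable (Function.uncurry l))
    (hkC : ∀ x y, |k x y| ≤ 1) (hlC : ∀ x y, |l x y| ≤ 1) (ε : ℝ)
    (h : ∀ x y, |k x y - l x y| ≤ ε) :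
    |dInt P N (fun x => dInt P N (k x)) - dInt P N (fun x => dInt P N (l x))|
      ≤ ε * (P.real Set.univ + N.real Set.univ) ^ 2 := by
  have := dInt_close P N _ _ (dInt_meas P N k hk) (dInt_meas P N l hl) _
    (fun x => dInt_bound P N (k x) 1 (hkC x)) (fun x => dInt_bound P N (l x) 1 (hlC x)) _
    (fun x => dInt_close P N (k x) (l x) hk.of_uncurry_left hl.of_uncurry_left 1
      (hkC x) (hlC x) ε (h x))
  calc _ ≤ _ := this
    _ = _ := by ring

lemma abs_exp_dist_le {B : Type*} [MetricSpace B] (x y : B) : |Real.exp (-dist x y)| ≤ 1 := by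
  rw [abs_of_pos (Real.exp_pos _)]
  exact Real.exp_le_one_iff.2 (by simp)

lemma meas_exp_dist {B : Type*} [MetricSpace B] [CompactSpace B] [MeasurableSpace B]
    [BorelSpace B] : Measurable (Function.uncurry fun x y : B => Real.exp (-dist x y)) := by
  have : Continuous (Function.uncurry fun x y : B => Real.exp (-dist x y)) := by
    unfold Function.uncurry; fun_prop
  exact this.measurable

lemma Zform_push {A B : Type*} [MeasurableSpace A] [MetricSpace B] [CompactSpace B]
    [MeasurableSpace B] [BorelSpace B] (P N : Measure A) [IsFiniteMeasure P] [IsFiniteMeasure N]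
    (f : A → B) (hf : Measurable f) :
    let ν := (P.map f).toSignedMeasure - (N.map f).toSignedMeasure
    Zform ν ν = dInt P N fun x => dInt P N fun y => Real.exp (-dist (f x) (f y)) := by
  intro ν
  have hm := meas_exp_dist (B := B)
  have h1 : ∀ x : B, sInt ν (fun y => Real.exp (-dist x y))
      = dInt P N fun y => Real.exp (-dist x (f y)) := by
    intro x
    have hx : Measurable fun y : B => Real.exp (-dist x y) := hm.of_uncurry_left
    rw [sInt_sub_aux _ _ _ hx 1 (fun y => abs_exp_dist_le x y),
      integral_map hf.aemeasurable hx.aestronglyMeasurable,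
      integral_map hf.aemeasurable hx.aestronglyMeasurable]
    rfl
  unfold Zform
  simp_rw [h1]
  have h2 : Measurable fun x : B => dInt P N fun y => Real.exp (-dist x (f y)) := by
    apply dInt_meas P N (fun (x : B) y => Real.exp (-dist x (f y)))
    exact hm.comp (measurable_fst.prodMk (hf.comp measurable_snd))
  rw [sInt_sub_aux _ _ _ h2 _ (fun x => dInt_bound P N _ 1 (fun y => abs_exp_dist_le x (f y))),
      integral_map hf.aemeasurable h2.aestronglyMeasurable,
      integral_map hf.aemeasurable h2.aestronglyMeasurable]
  rfl

lemma exists_simple_approx (A : Type*) [MetricSpace A] [CompactSpace A] [Nonempty A]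
    [MeasurableSpace A] [BorelSpace A] (δ : ℝ) (hδ : 0 < δ) :
    ∃ T : SimpleFunc A A, ∀ x, dist (T x) x ≤ δ := by
  obtain ⟨t, ht⟩ := isCompact_univ.elim_finite_subcover
    (fun n : ℕ => Metric.ball (TopologicalSpace.denseSeq A n) δ) (fun _ => Metric.isOpen_ball)
    (by
      intro x _
      obtain ⟨n, hn⟩ := (TopologicalSpace.denseRange_denseSeq A).exists_dist_lt x hδ
      exact Set.mem_iUnion.2 ⟨n, hn⟩)
  refine ⟨SimpleFunc.nearestPt (TopologicalSpace.denseSeq A) (t.sup id), fun x => ?_⟩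
  have hx := ht (Set.mem_univ x)
  simp only [Set.mem_iUnion] at hx
  obtain ⟨n, hn, hxn⟩ := hx
  have h1 := SimpleFunc.edist_nearestPt_le (TopologicalSpace.denseSeq A) x
    (Finset.le_sup (f := id) hn)
  rw [edist_dist, edist_dist, ENNReal.ofReal_le_ofReal_iff dist_nonneg] at h1
  have h2 : dist x (TopologicalSpace.denseSeq A n) < δ := hxn
  rw [dist_comm] at h2
  exact h1.trans h2.le

lemma exists_almost_isometry (A B : Type) [MetricSpace A] [CompactSpace A] [Nonempty A]
    [MeasurableSpace A] [BorelSpace A] [MetricSpace B] [CompactSpace B] [Nonempty B]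
    [MeasurableSpace B] (δ : ℝ) (hδ : 0 < δ)
    (h : GromovHausdorff.ghDist A B < δ) :
    ∃ f : A → B, Measurable f ∧ ∀ x y, |dist (f x) (f y) - dist x y| ≤ 4 * δ := by
  have key : ∀ a : A, ∃ b : B, dist (GromovHausdorff.optimalGHInjl A B a)
      (GromovHausdorff.optimalGHInjr A B b) < δ := by
    intro a
    rw [← GromovHausdorff.hausdorffDist_optimal] at h
    obtain ⟨y, ⟨b, rfl⟩, hb⟩ := Metric.exists_dist_lt_of_hausdorffDist_lt
      (Set.mem_range_self a) h
      (Metric.hausdorffEDist_ne_top_of_nonempty_of_bounded (Set.range_nonempty _)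
        (Set.range_nonempty _)
        (isCompact_range (GromovHausdorff.isometry_optimalGHInjl A B).continuous).isBounded
        (isCompact_range (GromovHausdorff.isometry_optimalGHInjr A B).continuous).isBounded)
    exact ⟨b, hb⟩
  choose g hg using key
  obtain ⟨T, hT⟩ := exists_simple_approx A δ hδ
  refine ⟨T.map g, (T.map g).measurable, fun x y => ?_⟩
  simp only [SimpleFunc.map_apply]
  have hl := fun u v => (GromovHausdorff.isometry_optimalGHInjl A B).dist_eq u v
  have hr := fun u v => (GromovHausdorff.isometry_optimalGHInjr A B).dist_eq u v
  have e1 : |dist (g (T x)) (g (T y)) - dist (T x) (T y)| ≤ 2 * δ := by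
    rw [← hl, ← hr, ← Real.dist_eq]
    refine (dist_dist_dist_le _ _ _ _).trans ?_
    have a1 := hg (T x)
    have a2 := hg (T y)
    rw [dist_comm] at a1 a2
    linarith
  have e2 : |dist (T x) (T y) - dist x y| ≤ 2 * δ := by
    rw [← Real.dist_eq]
    refine (dist_dist_dist_le _ _ _ _).trans ?_
    linarith [hT x, hT y]
  calc _ ≤ _ := abs_sub_le _ (dist (T x) (T y)) _
    _ ≤ _ := by linarith

theorem statement6 (A : Type) [MetricSpace A] [CompactSpace A] [Nonempty A]
    [MeasurableSpace A] [BorelSpace A] (hA : PosDefSpace A)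
    (r : ℝ) (hr : ENNReal.ofReal r < magnitude A) :
    ∃ δ : ℝ, 0 < δ ∧
      ∀ (B : Type) [MetricSpace B] [CompactSpace B] [Nonempty B]
        [MeasurableSpace B] [BorelSpace B],
        PosDefSpace B → GromovHausdorff.ghDist A B < δ →
          ENNReal.ofReal r < magnitude B := by
  unfold magnitude at hr
  simp only [lt_iSup_iff] at hr
  obtain ⟨μ, hZ0, hμ⟩ := hr
  have hpos : 0 < (μ Set.univ) ^ 2 / Zform μ μ :=
    ENNReal.ofReal_pos.1 (lt_of_le_of_lt zero_le hμ)
  rw [ENNReal.ofReal_lt_ofReal_iff hpos] at hμ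
  set m := μ Set.univ with hm
  set Z := Zform μ μ with hZ
  have hZpos : 0 < Z := by
    by_contra hc
    exact absurd hpos (not_lt.2 (div_nonpos_of_nonneg_of_nonpos (sq_nonneg _) (not_lt.1 hc)))
  set s := max r 0 with hs
  have hs0 : 0 ≤ s := le_max_right _ _
  have hsm : s * Z < m ^ 2 := by
    rw [← lt_div_iff₀ hZpos]; exact max_lt hμ hpos
  set P := μ.toJordanDecomposition.posPart with hP
  set N := μ.toJordanDecomposition.negPart with hN
  have hμPN : P.toSignedMeasure - N.toSignedMeasure = μ :=
    μ.toSignedMeasure_toJordanDecomposition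
  have hmPN : m = P.real Set.univ - N.real Set.univ := by
    rw [hm, ← hμPN]
    simp [Measure.toSignedMeasure_apply_measurable]
  set M := P.real Set.univ + N.real Set.univ with hM
  set η := min Z ((m ^ 2 - s * Z) / (s + 1)) with hη
  have hηpos : 0 < η := lt_min hZpos (div_pos (by linarith) (by linarith))
  have hη1 : η ≤ Z := min_le_left _ _
  have hη2 : η * (s + 1) ≤ m ^ 2 - s * Z := by
    rw [← le_div_iff₀ (by linarith)]; exact min_le_right _ _
  have hden : 0 < 4 * M ^ 2 + 1 := by positivity
  refine ⟨η / (4 * M ^ 2 + 1), div_pos hηpos hden, ?_⟩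
  intro B _ _ _ _ _ _ hgh
  set δ := η / (4 * M ^ 2 + 1) with hδ
  have hδpos : 0 < δ := div_pos hηpos hden
  have hδη : δ * (4 * M ^ 2 + 1) = η := by rw [hδ]; field_simp
  obtain ⟨f, hf, hfd⟩ := exists_almost_isometry A B δ hδpos hgh
  set ν := (P.map f).toSignedMeasure - (N.map f).toSignedMeasure with hν
  have hνm : ν Set.univ = m := by
    rw [hmPN, hν]
    simp [Measure.toSignedMeasure_apply_measurable, map_measureReal_apply hf MeasurableSet.univ]
  have hZν : Zform ν ν = dInt P N fun x => dInt P N fun y => Real.exp (-dist (f x) (f y)) :=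
    Zform_push P N f hf
  have hZμ : Z = dInt P N fun x => dInt P N fun y => Real.exp (-dist x y) := rfl
  have hclose : |Zform ν ν - Z| ≤ 4 * δ * M ^ 2 := by
    rw [hZν, hZμ]
    apply dInt2_close P N (fun x y => Real.exp (-dist (f x) (f y)))
      (fun x y => Real.exp (-dist x y)) _ meas_exp_dist
    · exact fun x y => abs_exp_dist_le _ _
    · exact fun x y => abs_exp_dist_le _ _
    · exact fun x y => (exp_neg_lip dist_nonneg dist_nonneg).trans (hfd x y)
    · exact meas_exp_dist.comp ((hf.comp measurable_fst).prodMk (hf.comp measurable_snd))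
  have hlt : |Zform ν ν - Z| < η := by
    refine lt_of_le_of_lt hclose ?_
    rw [← hδη]; linarith
  rw [abs_lt] at hlt
  have hZνpos : 0 < Zform ν ν := by linarith [hlt.1]
  have hfin : s < (ν Set.univ) ^ 2 / Zform ν ν := by
    rw [hνm, lt_div_iff₀ hZνpos]
    nlinarith [hlt.2]
  have hfinal : ENNReal.ofReal r < ENNReal.ofReal ((ν Set.univ) ^ 2 / Zform ν ν) := by
    rw [ENNReal.ofReal_lt_ofReal_iff (lt_of_le_of_lt hs0 hfin)]
    exact lt_of_le_of_lt (le_max_left _ _) hfin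
  unfold magnitude
  simp only [lt_iSup_iff]
  exact ⟨ν, hZνpos.ne', hfinal⟩
end

section
/- Let (A,d) be a nonempty compact positive definite metric space. Then the supremum in the definition of the maximum diversity |A|₊ is achieved: there exists a nonzero finite positive Borel measure μ on A such that μ(A)² / Z_A(μ,μ) = |A|₊. -/
open MeasureTheory Metric
open scoped ENNReal

lemma Zm_smul {A : Type*} [MetricSpace A] [MeasurableSpace A] (c : ℝ≥0∞) (μ : Measure A) :
    Zm (c • μ) (c • μ) = c.toReal ^ 2 * Zm μ μ := by
  unfold Zm
  simp only [integral_smul_measure, smul_eq_mul, integral_const_mul]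
  ring

lemma Zm_eq_prod {A : Type*} [MetricSpace A] [CompactSpace A] [MeasurableSpace A] [BorelSpace A]
    (p : ProbabilityMeasure A) :
    Zm (p : Measure A) p =
      ∫ z, Real.exp (-dist z.1 z.2) ∂((p.prod p : ProbabilityMeasure (A × A)) : Measure (A × A)) := by
  have hc : Continuous fun z : A × A => Real.exp (-dist z.1 z.2) := by fun_prop
  have hi : Integrable (fun z : A × A => Real.exp (-dist z.1 z.2))
      ((p : Measure A).prod (p : Measure A)) :=
    hc.integrable_of_hasCompactSupport (HasCompactSupport.of_compactSpace _)
  rw [ProbabilityMeasure.toMeasure_prod, integral_prod _ hi]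
  rfl

lemma Zm_continuous {A : Type*} [MetricSpace A] [CompactSpace A] [MeasurableSpace A]
    [BorelSpace A] :
    Continuous fun p : ProbabilityMeasure A => Zm (p : Measure A) p := by
  simp only [Zm_eq_prod]
  have hc : Continuous fun z : A × A => Real.exp (-dist z.1 z.2) := by fun_prop
  have h1 := ProbabilityMeasure.continuous_integral_continuousMap
    (⟨_, hc⟩ : C(A × A, ℝ))
  have h2 : Continuous fun p : ProbabilityMeasure A => p.prod p :=
    ProbabilityMeasure.continuous_prod.comp (continuous_id.prodMk continuous_id)
  exact h1.comp h2

lemma Zm_pos {A : Type*} [MetricSpace A] [CompactSpace A] [MeasurableSpace A] [BorelSpace A]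
    (p : ProbabilityMeasure A) : 0 < Zm (p : Measure A) p := by
  rw [Zm_eq_prod]
  have hc : Continuous fun z : A × A => Real.exp (-dist z.1 z.2) := by fun_prop
  exact integral_exp_pos
    (hc.integrable_of_hasCompactSupport (HasCompactSupport.of_compactSpace _))

theorem statement8 (A : Type*) [MetricSpace A] [CompactSpace A] [Nonempty A]
    [MeasurableSpace A] [BorelSpace A] (hA : PosDefSpace A) :
    ∃ μ : Measure A, IsFiniteMeasure μ ∧ μ ≠ 0 ∧
      IsGreatest
        {r : ℝ | ∃ ν : Measure A, IsFiniteMeasure ν ∧ ν ≠ 0 ∧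
          r = (ν Set.univ).toReal ^ 2 / Zm ν ν}
        ((μ Set.univ).toReal ^ 2 / Zm μ μ) := by
  have : Nonempty (ProbabilityMeasure A) :=
    ⟨⟨Measure.dirac (Classical.arbitrary A), inferInstance⟩⟩
  obtain ⟨p, -, hp⟩ := isCompact_univ.exists_isMinOn Set.univ_nonempty
    (Zm_continuous (A := A)).continuousOn
  have hp0 : (p : Measure A) ≠ 0 := IsProbabilityMeasure.ne_zero _
  refine ⟨p, inferInstance, hp0, ⟨p, inferInstance, hp0, rfl⟩, ?_⟩
  rintro r ⟨ν, hν, hν0, rfl⟩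
  have hu : ν Set.univ ≠ 0 := by simpa using hν0
  have ht : ν Set.univ ≠ ∞ := measure_ne_top _ _
  have hm : 0 < (ν Set.univ).toReal := ENNReal.toReal_pos hu ht
  have : NeZero ν := ⟨hν0⟩
  let q : ProbabilityMeasure A := ⟨(ν Set.univ)⁻¹ • ν, inferInstance⟩
  have hq : ν = (ν Set.univ) • (q : Measure A) := by
    change ν = (ν Set.univ) • ((ν Set.univ)⁻¹ • ν)
    rw [smul_smul, ENNReal.mul_inv_cancel hu ht, one_smul]
  have hZ : Zm ν ν = (ν Set.univ).toReal ^ 2 * Zm (q : Measure A) q := by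
    conv_lhs => rw [hq]
    exact Zm_smul _ _
  have hle : Zm (p : Measure A) p ≤ Zm (q : Measure A) q := hp (Set.mem_univ q)
  have h1 := Zm_pos p
  have h2 := Zm_pos q
  rw [hZ, measure_univ (μ := (p : Measure A)), ENNReal.toReal_one, one_pow]
  rw [div_mul_eq_div_div, div_self (by positivity)]
  exact one_div_le_one_div_of_le h1 hle
end

section
/- Let (A,d) be a nonempty compact positive definite metric space which is positively weighted, i.e., its magnitude equals its maximum diversity: |A| = |A|₊. Then A possesses a positive weight measure: there exists a finite positive Borel measure μ on A such that ∫_A e^{−d(x,y)} dμ(y) = 1 for every x ∈ A. -/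
open MeasureTheory Metric
open scoped ENNReal

section helpers

open scoped NNReal

lemma aux_sInt {A : Type*} [MeasurableSpace A] (μ ν : Measure A) [IsFiniteMeasure μ]
    [IsFiniteMeasure ν] (f : A → ℝ)
    (hf : ∀ ρ : Measure A, IsFiniteMeasure ρ → Integrable f ρ) :
    sInt (μ.toSignedMeasure - ν.toSignedMeasure) f = ∫ x, f x ∂μ - ∫ x, f x ∂ν := by
  unfold sInt
  set s := μ.toSignedMeasure - ν.toSignedMeasure with hs
  have h1 := s.toSignedMeasure_toJordanDecomposition
  unfold JordanDecomposition.toSignedMeasure at h1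
  set P := s.toJordanDecomposition.posPart
  set N := s.toJordanDecomposition.negPart
  have h2 : P.toSignedMeasure + ν.toSignedMeasure = μ.toSignedMeasure + N.toSignedMeasure := by
    rw [hs] at h1
    rw [← sub_eq_sub_iff_add_eq_add]
    exact h1
  rw [← Measure.toSignedMeasure_add, ← Measure.toSignedMeasure_add,
    Measure.toSignedMeasure_eq_toSignedMeasure_iff] at h2
  have h3 : ∫ x, f x ∂(P + ν) = ∫ x, f x ∂(μ + N) := by rw [h2]
  rw [integral_add_measure (hf _ inferInstance) (hf _ inferInstance),
    integral_add_measure (hf _ inferInstance) (hf _ inferInstance)] at h3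
  linarith

lemma aux_int {A : Type*} [MetricSpace A] [CompactSpace A] [MeasurableSpace A] [BorelSpace A]
    {f : A → ℝ} (hf : Continuous f) (ρ : Measure A) (_ : IsFiniteMeasure ρ) : Integrable f ρ :=
  hf.integrable_of_hasCompactSupport (HasCompactSupport.of_compactSpace f)

lemma aux_cont {A : Type*} [MetricSpace A] [CompactSpace A] [MeasurableSpace A] [BorelSpace A]
    (μ : Measure A) [IsFiniteMeasure μ] :
    Continuous fun x : A => ∫ y, Real.exp (-dist x y) ∂μ := by
  apply continuous_of_dominated (bound := fun _ => 1)
  · intro x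
    exact (by fun_prop : Continuous fun y : A => Real.exp (-dist x y)).aestronglyMeasurable
  · intro x
    refine Filter.Eventually.of_forall fun y => ?_
    rw [Real.norm_eq_abs, Real.abs_exp]
    simp
  · exact integrable_const _
  · refine Filter.Eventually.of_forall fun y => ?_
    fun_prop

lemma aux_sInt' {A : Type*} [MetricSpace A] [CompactSpace A] [MeasurableSpace A] [BorelSpace A]
    (μ : Measure A) [IsFiniteMeasure μ] (x : A) (a b : ℝ≥0) {f : A → ℝ} (hf : Continuous f) :
    sInt ((μ + a • Measure.dirac x).toSignedMeasure - (b • Measure.dirac x).toSignedMeasure) f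
      = ∫ y, f y ∂μ + ((a : ℝ) - b) * f x := by
  rw [aux_sInt _ _ _ (aux_int hf),
    integral_add_measure (aux_int hf _ inferInstance) (aux_int hf _ inferInstance),
    integral_smul_nnreal_measure, integral_smul_nnreal_measure, integral_dirac]
  simp only [NNReal.smul_def, smul_eq_mul]
  ring

lemma aux_Z {A : Type*} [MetricSpace A] [CompactSpace A] [MeasurableSpace A] [BorelSpace A]
    (μ : Measure A) [IsFiniteMeasure μ] (x : A) (a b : ℝ≥0) :
    Zform ((μ + a • Measure.dirac x).toSignedMeasure - (b • Measure.dirac x).toSignedMeasure)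
      ((μ + a • Measure.dirac x).toSignedMeasure - (b • Measure.dirac x).toSignedMeasure)
      = Zm μ μ + 2 * ((a : ℝ) - b) * ∫ y, Real.exp (-dist x y) ∂μ + ((a : ℝ) - b) ^ 2 := by
  unfold Zform
  have h1 : ∀ y : A, Continuous fun z : A => Real.exp (-dist y z) := fun y => by fun_prop
  have h1' : Continuous fun z : A => Real.exp (-dist z x) := by fun_prop
  simp_rw [fun y => aux_sInt' μ x a b (h1 y)]
  have h2 := aux_cont μ
  have h3 : Continuous fun z : A => ∫ y, Real.exp (-dist z y) ∂μ
      + ((a : ℝ) - b) * Real.exp (-dist z x) := h2.add (h1'.const_mul ((a : ℝ) - b))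
  rw [aux_sInt' μ x a b h3,
    integral_add (aux_int h2 _ inferInstance)
      (aux_int (h1'.const_mul ((a : ℝ) - b)) _ inferInstance), integral_const_mul]
  simp_rw [dist_comm _ x]
  unfold Zm
  simp only [dist_self, neg_zero, Real.exp_zero]
  ring

lemma aux_min (A : Type*) [MetricSpace A] [CompactSpace A] [Nonempty A]
    [MeasurableSpace A] [BorelSpace A] :
    ∃ μ : Measure A, IsProbabilityMeasure μ ∧
      ∀ ν : Measure A, IsProbabilityMeasure ν → Zm μ μ ≤ Zm ν ν := by
  have : Nonempty (ProbabilityMeasure A) :=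
    ⟨⟨Measure.dirac (Classical.arbitrary A), inferInstance⟩⟩
  let k : C(A × A, ℝ) := ⟨fun p => Real.exp (-dist p.1 p.2), by fun_prop⟩
  have hk : ∀ μ : ProbabilityMeasure A,
      Zm (μ : Measure A) μ = ∫ p, k p ∂((μ.prod μ : ProbabilityMeasure (A × A)) : Measure _) := by
    intro μ
    rw [ProbabilityMeasure.toMeasure_prod, integral_prod]
    · rfl
    · exact aux_int k.continuous _ inferInstance
  have hc : Continuous fun μ : ProbabilityMeasure A => Zm (μ : Measure A) μ := by
    simp_rw [hk]
    exact (ProbabilityMeasure.continuous_integral_continuousMap k).comp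
      (ProbabilityMeasure.continuous_prod.comp (continuous_id.prodMk continuous_id))
  obtain ⟨μ, -, hμ⟩ := isCompact_univ.exists_isMinOn Set.univ_nonempty hc.continuousOn
  exact ⟨μ, inferInstance, fun ν hν => hμ (Set.mem_univ (⟨ν, hν⟩ : ProbabilityMeasure A))⟩

lemma aux_real {m h : ℝ} (hm : 0 < m) 
    (H : ∀ t : ℝ, |t| ≤ m / 4 → m * (1 + t) ^ 2 ≤ m + 2 * t * h + t ^ 2) : h = m := by
  rcases lt_trichotomy h m with hl | hl | hl
  · have h0 : 0 < min (m / 4) (m - h) := lt_min (by linarith) (by linarith)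
    have := H _ ((abs_of_pos h0).le.trans (min_le_left _ _))
    have h2 := min_le_right (m / 4) (m - h)
    set t := min (m / 4) (m - h)
    nlinarith [mul_pos h0 h0, mul_pos hm (mul_pos h0 h0), mul_le_mul_of_nonneg_left h2 h0.le]
  · exact hl
  · have h0 : 0 < min (m / 4) (h - m) := lt_min (by linarith) (by linarith)
    have := H (- min (m / 4) (h - m)) (by
      rw [abs_neg]; exact (abs_of_pos h0).le.trans (min_le_left _ _))
    have h2 := min_le_right (m / 4) (h - m)
    set t := min (m / 4) (h - m)
    nlinarith [mul_pos h0 h0, mul_pos hm (mul_pos h0 h0), mul_le_mul_of_nonneg_left h2 h0.le]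

end helpers

theorem statement9 (A : Type*) [MetricSpace A] [CompactSpace A] [Nonempty A]
    [MeasurableSpace A] [BorelSpace A] (hA : PosDefSpace A)
    (hpw : magnitude A = maxDivE A) :
    ∃ μ : Measure A, IsFiniteMeasure μ ∧
      ∀ x : A, ∫ y, Real.exp (-dist x y) ∂μ = 1 := by
  obtain ⟨μ, hμ, hmin⟩ := aux_min A
  have hpos : ∀ x, 0 < ∫ y, Real.exp (-dist x y) ∂μ := fun x =>
    integral_exp_pos (aux_int (by fun_prop) _ inferInstance)
  have hle : ∀ x, ∫ y, Real.exp (-dist x y) ∂μ ≤ 1 := fun x => by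
    calc _ ≤ ∫ y : A, (1 : ℝ) ∂μ := integral_mono (aux_int (by fun_prop) _ inferInstance)
            (integrable_const _) (fun y => by simp)
      _ = 1 := by simp
  have hm : 0 < Zm μ μ := by
    unfold Zm
    rw [integral_pos_iff_support_of_nonneg (fun x => (hpos x).le)
      (aux_int (aux_cont μ) _ inferInstance)]
    rw [Function.support_eq_univ fun x => (hpos x).ne']
    simp
  set m := Zm μ μ with hmdef
  have hdiv : maxDivE A ≤ ENNReal.ofReal (1 / m) := by
    unfold maxDivE
    refine iSup₂_le fun ν hν => ENNReal.ofReal_le_ofReal ?_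
    obtain ⟨hν, hν0⟩ := hν
    have hM : 0 < (ν Set.univ).toReal :=
      ENNReal.toReal_pos (by simpa using hν0) (measure_ne_top _ _)
    have : NeZero ν := ⟨hν0⟩
    have h1 := hmin ((ν Set.univ)⁻¹ • ν) inferInstance
    have h2 : Zm ((ν Set.univ)⁻¹ • ν) ((ν Set.univ)⁻¹ • ν)
        = Zm ν ν / (ν Set.univ).toReal ^ 2 := by
      unfold Zm
      simp only [integral_smul_measure, ENNReal.toReal_inv, smul_eq_mul, integral_const_mul]
      field_simp
    rw [h2, le_div_iff₀ (by positivity)] at h1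
    rw [div_le_div_iff₀ (lt_of_lt_of_le (by positivity) h1) hm]
    linarith
  have key : ∀ x, ∫ y, Real.exp (-dist x y) ∂μ = m := by
    intro x
    apply aux_real hm
    intro t ht
    have hx := hpos x
    have hx1 := hle x
    have hZ := aux_Z μ x t.toNNReal (-t).toNNReal
    have ht' : ((t.toNNReal : ℝ) - (-t).toNNReal) = t := by
      rw [Real.coe_toNNReal', Real.coe_toNNReal']
      exact max_zero_sub_max_neg_zero_eq_self t
    rw [ht'] at hZ
    set s := (μ + t.toNNReal • Measure.dirac x).toSignedMeasure
      - ((-t).toNNReal • Measure.dirac x).toSignedMeasure with hs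
    have hsu : s Set.univ = 1 + t := by
      rw [hs, Measure.toSignedMeasure_sub_apply MeasurableSet.univ]
      rw [measureReal_add_apply]
      simp only [measureReal_nnreal_smul_apply, probReal_univ, smul_eq_mul, mul_one]
      linarith
    have hZpos : 0 < Zform s s := by
      rw [hZ, ← hmdef]
      obtain ⟨h1, h2⟩ := abs_le.mp ht
      nlinarith [mul_le_mul_of_nonneg_right h1 hx.le]
    have h3 : ENNReal.ofReal ((s Set.univ) ^ 2 / Zform s s) ≤ ENNReal.ofReal (1 / m) :=
      (le_iSup₂_of_le (f := fun (μ : SignedMeasure A) (_ : Zform μ μ ≠ 0) =>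
        ENNReal.ofReal ((μ Set.univ) ^ 2 / Zform μ μ)) s hZpos.ne' le_rfl).trans
        (hpw.le.trans hdiv)
    rw [ENNReal.ofReal_le_ofReal_iff (by positivity), div_le_div_iff₀ hZpos hm, hsu, hZ] at h3
    linarith
  refine ⟨(Real.toNNReal m⁻¹) • μ, inferInstance, fun x => ?_⟩
  rw [integral_smul_nnreal_measure, key, NNReal.smul_def, Real.coe_toNNReal _ (by positivity),
    smul_eq_mul, inv_mul_cancel₀ hm.ne']
end

section
/- Maximum diversity is continuous with respect to the Gromov–Hausdorff distance on the class of nonempty compact positive definite metric spaces: for every nonempty compact positive definite metric space A and every ε > 0 there exists δ > 0 such that every nonempty compact positive definite metric space B with Gromov–Hausdorff distance d_GH(A,B) < δ satisfies | |B|₊ − |A|₊ | < ε. -/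
open MeasureTheory Metric
open scoped ENNReal

/-- The maximum diversity of a compact positive definite metric space, as a
real number. -/
noncomputable def maxDiv (A : Type*) [MetricSpace A] [MeasurableSpace A] : ℝ :=
  sSup {r : ℝ | ∃ μ : Measure A, IsFiniteMeasure μ ∧ μ ≠ 0 ∧
    r = (μ Set.univ).toReal ^ 2 / Zm μ μ}

section helpers

variable {A : Type} [MetricSpace A] [CompactSpace A] [MeasurableSpace A] [BorelSpace A]

lemma kern_cont (x : A) : Continuous fun y : A => Real.exp (-dist x y) := by fun_prop

lemma kern_le_one (x y : A) : Real.exp (-dist x y) ≤ 1 :=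
  Real.exp_le_one_iff.2 (neg_nonpos.2 dist_nonneg)

lemma kern_int (μ : Measure A) [IsFiniteMeasure μ] (x : A) :
    Integrable (fun y : A => Real.exp (-dist x y)) μ := by
  refine Integrable.of_bound (C := 1) (kern_cont x).aestronglyMeasurable ?_
  filter_upwards with y
  rw [Real.norm_eq_abs, abs_of_pos (Real.exp_pos _)]
  exact kern_le_one x y

lemma pot_cont (μ : Measure A) [IsFiniteMeasure μ] :
    Continuous fun x : A => ∫ y, Real.exp (-dist x y) ∂μ := by
  refine continuous_of_dominated (bound := fun _ => 1)
    (fun x => (kern_cont x).aestronglyMeasurable) ?_ (integrable_const _) ?_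
  · intro x
    filter_upwards with y
    rw [Real.norm_eq_abs, abs_of_pos (Real.exp_pos _)]
    exact kern_le_one x y
  · filter_upwards with y
    fun_prop

lemma cont_int (μ : Measure A) [IsFiniteMeasure μ] {g : A → ℝ} (hg : Continuous g) :
    Integrable g μ := by
  exact hg.integrable_of_hasCompactSupport (HasCompactSupport.of_compactSpace g)

lemma mass_pos (μ : Measure A) [IsFiniteMeasure μ] (h : μ ≠ 0) : 0 < (μ Set.univ).toReal :=
  ENNReal.toReal_pos (by simpa using h) (measure_ne_top _ _)

lemma Zm_lower (μ : Measure A) [IsFiniteMeasure μ] :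
    Real.exp (-diam (Set.univ : Set A)) * (μ Set.univ).toReal ^ 2 ≤ Zm μ μ := by
  have h1 : ∀ x : A, Real.exp (-diam (Set.univ : Set A)) * (μ Set.univ).toReal ≤
      ∫ y, Real.exp (-dist x y) ∂μ := by
    intro x
    have : ∫ _y : A, Real.exp (-diam (Set.univ : Set A)) ∂μ ≤ ∫ y, Real.exp (-dist x y) ∂μ := by
      refine integral_mono (integrable_const _) (kern_int μ x) fun y => ?_
      exact Real.exp_le_exp.2 (neg_le_neg (dist_le_diam_of_mem isCompact_univ.isBounded
        (Set.mem_univ _) (Set.mem_univ _)))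
    rw [integral_const, smul_eq_mul, Measure.real] at this
    linarith
  have h2 : ∫ _x : A, Real.exp (-diam (Set.univ : Set A)) * (μ Set.univ).toReal ∂μ ≤ Zm μ μ :=
    integral_mono (integrable_const _) (cont_int μ (pot_cont μ)) h1
  rw [integral_const, smul_eq_mul, Measure.real] at h2
  linarith

lemma Zm_pos_s10 (μ : Measure A) [IsFiniteMeasure μ] (h : μ ≠ 0) : 0 < Zm μ μ :=
  lt_of_lt_of_le (mul_pos (Real.exp_pos _) (pow_pos (mass_pos μ h) 2)) (Zm_lower μ)

variable (A) in
lemma bdd : BddAbove {r : ℝ | ∃ μ : Measure A, IsFiniteMeasure μ ∧ μ ≠ 0 ∧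
    r = (μ Set.univ).toReal ^ 2 / Zm μ μ} := by
  refine ⟨Real.exp (diam (Set.univ : Set A)), ?_⟩
  rintro r ⟨μ, hμ, h0, rfl⟩
  rw [div_le_iff₀ (Zm_pos_s10 μ h0)]
  have := mul_le_mul_of_nonneg_left (Zm_lower μ) (Real.exp_pos (diam (Set.univ : Set A))).le
  rwa [← mul_assoc, ← Real.exp_add, add_neg_cancel, Real.exp_zero, one_mul] at this

variable (A) in
lemma maxDiv_nonneg : 0 ≤ maxDiv A := by
  refine Real.sSup_nonneg ?_
  rintro r ⟨μ, hμ, h0, rfl⟩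
  exact div_nonneg (sq_nonneg _) (Zm_pos_s10 μ h0).le

variable {B : Type} [MetricSpace B] [CompactSpace B] [MeasurableSpace B] [BorelSpace B]

lemma maxDiv_le_of_map (f : A → B) (hf : Measurable f) (η : ℝ)
    (h : ∀ x y, dist x y ≤ dist (f x) (f y) + η) :
    maxDiv A ≤ Real.exp η * maxDiv B := by
  refine Real.sSup_le ?_ (mul_nonneg (Real.exp_pos _).le (maxDiv_nonneg B))
  rintro r ⟨μ, hμ, h0, rfl⟩
  have hfin : IsFiniteMeasure (μ.map f) := inferInstance
  have hm : (μ.map f) Set.univ = μ Set.univ := by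
    rw [Measure.map_apply hf MeasurableSet.univ, Set.preimage_univ]
  have hn0 : μ.map f ≠ 0 := by
    rw [← Measure.measure_univ_ne_zero, hm]
    simpa using h0
  have hle : ((μ.map f) Set.univ).toReal ^ 2 / Zm (μ.map f) (μ.map f) ≤ maxDiv B :=
    le_csSup (bdd B) ⟨_, hfin, hn0, rfl⟩
  have hZ : Zm (μ.map f) (μ.map f) ≤ Real.exp η * Zm μ μ := by
    unfold Zm
    rw [integral_map hf.aemeasurable (pot_cont _).aestronglyMeasurable, ← integral_const_mul]
    have hi : Integrable (fun x => ∫ y, Real.exp (-dist (f x) y) ∂(μ.map f)) μ :=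
      (cont_int (μ.map f) (pot_cont (μ.map f))).comp_measurable hf
    refine integral_mono hi ((cont_int μ (pot_cont μ)).const_mul _) fun x => ?_
    simp only
    rw [integral_map hf.aemeasurable (kern_cont _).aestronglyMeasurable, ← integral_const_mul]
    refine integral_mono ((kern_int (μ.map f) (f x)).comp_measurable hf)
      ((kern_int μ x).const_mul _) fun y => ?_
    simp only
    rw [← Real.exp_add, Real.exp_le_exp]
    linarith [h x y]
  refine le_trans ?_ (mul_le_mul_of_nonneg_left hle (Real.exp_pos _).le)
  rw [hm, ← mul_div_assoc, div_le_div_iff₀ (Zm_pos_s10 μ h0) (Zm_pos_s10 _ hn0)]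
  nlinarith [mul_le_mul_of_nonneg_left hZ (sq_nonneg (μ Set.univ).toReal)]

lemma maxDiv_le_of_embed [Nonempty B] {X : Type} [MetricSpace X] (i : A → X) (j : B → X)
    (hi : Isometry i) (hj : Isometry j) (δ : ℝ) (h : ∀ x, ∃ y, dist (i x) (j y) < δ) :
    maxDiv A ≤ Real.exp (2 * δ) * maxDiv B := by
  classical
  let b := TopologicalSpace.denseSeq B
  have hb : ∀ x, ∃ n, dist (i x) (j (b n)) < δ := by
    intro x
    have ho : IsOpen {y : B | dist (i x) (j y) < δ} :=
      isOpen_lt (continuous_const.dist hj.continuous) continuous_const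
    obtain ⟨y, hy, n, rfl⟩ := (TopologicalSpace.denseRange_denseSeq B).inter_open_nonempty _ ho (h x)
    exact ⟨n, hy⟩
  have hN : Measurable fun x => Nat.find (hb x) := by
    refine measurable_find hb fun n => ?_
    exact (isOpen_lt (hi.continuous.dist continuous_const) continuous_const).measurableSet
  refine maxDiv_le_of_map (fun x => b (Nat.find (hb x)))
    ((measurable_of_countable b).comp hN) _ fun x y => ?_
  have h1 := Nat.find_spec (hb x)
  have h2 := Nat.find_spec (hb y)
  rw [← hi.dist_eq, ← hj.dist_eq]
  have h3 := dist_triangle4 (i x) (j (b (Nat.find (hb x)))) (j (b (Nat.find (hb y)))) (i y)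
  rw [dist_comm (i y)] at h2
  linarith

end helpers

theorem statement10 (A : Type) [MetricSpace A] [CompactSpace A] [Nonempty A]
    [MeasurableSpace A] [BorelSpace A] (hA : PosDefSpace A)
    (ε : ℝ) (hε : 0 < ε) :
    ∃ δ : ℝ, 0 < δ ∧
      ∀ (B : Type) [MetricSpace B] [CompactSpace B] [Nonempty B]
        [MeasurableSpace B] [BorelSpace B],
        PosDefSpace B → GromovHausdorff.ghDist A B < δ →
          |maxDiv B - maxDiv A| < ε := by
  have hA0 := maxDiv_nonneg A
  have ht : Filter.Tendsto (fun δ : ℝ => (Real.exp (2 * δ) - 1) * maxDiv A) (nhds 0) (nhds 0) := by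
    have : Continuous (fun δ : ℝ => (Real.exp (2 * δ) - 1) * maxDiv A) := by fun_prop
    simpa using this.tendsto 0
  obtain ⟨r, hr, hrb⟩ := Metric.eventually_nhds_iff.1 (ht.eventually (gt_mem_nhds hε))
  refine ⟨r / 2, by positivity, ?_⟩
  intro B _ _ _ _ _ _ hd
  have hE := @hrb (r / 2) (by rw [Real.dist_eq, sub_zero, abs_of_pos] <;> linarith)
  rw [← GromovHausdorff.hausdorffDist_optimal] at hd
  have hil := GromovHausdorff.isometry_optimalGHInjl A B
  have hir := GromovHausdorff.isometry_optimalGHInjr A B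
  have hne : hausdorffEDist (Set.range (GromovHausdorff.optimalGHInjl A B))
      (Set.range (GromovHausdorff.optimalGHInjr A B)) ≠ ⊤ :=
    hausdorffEDist_ne_top_of_nonempty_of_bounded (Set.range_nonempty _) (Set.range_nonempty _)
      (isCompact_range hil.continuous).isBounded (isCompact_range hir.continuous).isBounded
  have h1 : maxDiv A ≤ Real.exp (2 * (r / 2)) * maxDiv B := by
    refine maxDiv_le_of_embed _ _ hil hir _ fun x => ?_
    obtain ⟨_, ⟨y, rfl⟩, hy⟩ := exists_dist_lt_of_hausdorffDist_lt (Set.mem_range_self x) hd hne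
    exact ⟨y, hy⟩
  have h2 : maxDiv B ≤ Real.exp (2 * (r / 2)) * maxDiv A := by
    refine maxDiv_le_of_embed _ _ hir hil _ fun x => ?_
    obtain ⟨_, ⟨y, rfl⟩, hy⟩ := exists_dist_lt_of_hausdorffDist_lt' (Set.mem_range_self x) hd hne
    exact ⟨y, by rwa [dist_comm]⟩
  have hB0 := maxDiv_nonneg B
  have hE1 : 1 ≤ Real.exp (2 * (r / 2)) := Real.one_le_exp (by linarith)
  generalize Real.exp (2 * (r / 2)) = E at *
  rw [abs_lt]
  constructor
  · by_cases hc : maxDiv B ≤ maxDiv A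
    · nlinarith [mul_le_mul_of_nonneg_left hc (sub_nonneg.2 hE1)]
    · linarith
  · linarith
end

section
/- Let (A,d) be a metric space and suppose there exists a sequence (t_k) of positive real numbers with t_k → 0 such that for each k the rescaled space t_k A = (A, t_k·d) is positive semidefinite. Then A is stably positive definite: for every t > 0 the space tA = (A, t·d) is positive definite. -/
open scoped ENNReal

/-- The rescaled space `tA = (A, t·d)` is positive definite: every finite subspace
has positive definite similarity matrix `[e^{-t·d(x,y)}]`. -/
def ScaledPosDef (A : Type*) [MetricSpace A] (t : ℝ) : Prop :=
  ∀ s : Finset A, (Matrix.of fun x y : ↥s => Real.exp (-(t * dist (x : A) (y : A)))).PosDef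

/-- The rescaled space `tA = (A, t·d)` is positive semidefinite: every finite
subspace has positive semidefinite similarity matrix `[e^{-t·d(x,y)}]`. -/
def ScaledPosSemidef (A : Type*) [MetricSpace A] (t : ℝ) : Prop :=
  ∀ s : Finset A, (Matrix.of fun x y : ↥s => Real.exp (-(t * dist (x : A) (y : A)))).PosSemidef

namespace Aux12

open Matrix Finset

variable {ι : Type*} [Fintype ι]

lemma quad_eq (M : Matrix ι ι ℝ) (x : ι → ℝ) :
    star x ⬝ᵥ (M *ᵥ x) = ∑ i, ∑ j, x i * M i j * x j := by
  simp [dotProduct, mulVec, Finset.mul_sum, mul_assoc]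

lemma psd_of {M : Matrix ι ι ℝ} (hs : ∀ i j, M i j = M j i)
    (h : ∀ x : ι → ℝ, 0 ≤ ∑ i, ∑ j, x i * M i j * x j) : M.PosSemidef := by
  refine PosSemidef.of_dotProduct_mulVec_nonneg ?_ fun x => ?_
  · ext i j
    simp [conjTranspose_apply, hs i j]
  · rw [quad_eq]; exact h x

lemma psd_quad {M : Matrix ι ι ℝ} (hM : M.PosSemidef) (x : ι → ℝ) :
    0 ≤ ∑ i, ∑ j, x i * M i j * x j := by
  rw [← quad_eq]; exact hM.dotProduct_mulVec_nonneg x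

lemma psd_symm {M : Matrix ι ι ℝ} (hM : M.PosSemidef) (i j : ι) : M i j = M j i := by
  have := hM.isHermitian.apply i j
  simpa using this.symm

lemma psd_hpow {E : Matrix ι ι ℝ} (hE : E.PosSemidef) (k : ℕ) :
    (Matrix.of fun i j => E i j ^ k).PosSemidef := by
  induction k with
  | zero =>
    refine psd_of (by simp) fun x => ?_
    have : ∑ i, ∑ j, x i * (Matrix.of fun i j => E i j ^ 0) i j * x j = (∑ i, x i) ^ 2 := by
      simp [sq, Finset.sum_mul_sum]
    rw [this]; positivity
  | succ k ih =>
    have h := ih.hadamard hE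
    have e : (Matrix.of fun i j => E i j ^ (k + 1)) = (Matrix.of fun i j => E i j ^ k) ⊙ E := by
      ext i j
      simp [pow_succ]
    rw [e]; exact h

lemma psd_shift [DecidableEq ι] {K : Matrix ι ι ℝ} (hK : K.PosSemidef) (q : ι)
    (hq : K q q = 1) (hne : ∀ i, K i q ≠ 0) :
    (Matrix.of fun i j => K i j / (K i q * K j q) - 1).PosSemidef := by
  refine psd_of (fun i j => ?_) fun x => ?_
  · simp only [of_apply]; rw [psd_symm hK i j, mul_comm (K i q)]
  · set m := ∑ i, x i with hm
    have h := psd_quad hK (fun i => x i / K i q - if i = q then m else 0)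
    have key : ∑ i, ∑ j, (x i / K i q - if i = q then m else 0) * K i j *
          (x j / K j q - if j = q then m else 0)
        = ∑ i, ∑ j, x i * (Matrix.of fun i j => K i j / (K i q * K j q) - 1) i j * x j := by
      have e1 : ∀ i, ∑ j, (x i / K i q - if i = q then m else 0) * K i j *
          (x j / K j q - if j = q then m else 0) =
          ∑ j, x i / K i q * K i j * (x j / K j q) - x i * m
            - if i = q then (m * m - m * m) else 0 := by
        intro i
        simp only [mul_sub, Finset.sum_sub_distrib, mul_ite, mul_zero, Finset.sum_ite_eq',
          Finset.mem_univ, if_true]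
        by_cases hi : i = q
        · subst hi
          simp only [if_true, hq]
          have : ∀ j, (x i / 1 - m) * K i j * (x j / K j i) =
              x i / 1 * K i j * (x j / K j i) - m * x j := by
            intro j
            rw [psd_symm hK i j]
            field_simp [hne j]
          simp only [this, Finset.sum_sub_distrib, ← Finset.mul_sum, ← hm]
          ring
        · simp only [hi, if_false, sub_zero]
          rw [div_mul_cancel₀ _ (hne i)]
      simp only [e1, sub_self, ite_self, sub_zero]
      refine Finset.sum_congr rfl fun i _ => ?_
      rw [hm, Finset.mul_sum, ← Finset.sum_sub_distrib]
      refine Finset.sum_congr rfl fun j _ => ?_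
      simp only [of_apply]
      field_simp [hne i, hne j]
    rw [← key]; exact h

/-- If the quadratic form of the `N`-th Hadamard power of `1 + E` vanishes at `c`, then so do
all the rows of the lower Hadamard powers of `E` against `c`. -/
lemma row_zero {E : Matrix ι ι ℝ} (hE : E.PosSemidef) (N : ℕ) (c : ι → ℝ)
    (h : ∑ i, ∑ j, c i * (E i j + 1) ^ N * c j = 0) (k : ℕ) (hk : k ≤ N) (p : ι) :
    ∑ j, E p j ^ k * c j = 0 := by
  have e : ∑ i, ∑ j, c i * (E i j + 1) ^ N * c j =
      ∑ k ∈ range (N + 1), (N.choose k : ℝ) * ∑ i, ∑ j, c i * E i j ^ k * c j := by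
    simp only [add_pow, one_pow, mul_one, Finset.mul_sum, Finset.sum_mul]
    rw [Finset.sum_comm (s := range (N + 1))]
    refine Finset.sum_congr rfl fun i _ => ?_
    rw [Finset.sum_comm (s := range (N + 1))]
    refine Finset.sum_congr rfl fun j _ => Finset.sum_congr rfl fun k _ => by ring
  rw [e] at h
  have nn : ∀ k, 0 ≤ ∑ i, ∑ j, c i * E i j ^ k * c j := fun k => psd_quad (psd_hpow hE k) c
  have z := (Finset.sum_eq_zero_iff_of_nonneg
    (fun k _ => mul_nonneg (Nat.cast_nonneg _) (nn k))).1 h k (by simp; omega)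
  have hc : (N.choose k : ℝ) ≠ 0 := by
    exact_mod_cast (Nat.choose_pos hk).ne'
  have z' := (mul_eq_zero.1 z).resolve_left hc
  have := ((psd_hpow hE k).dotProduct_mulVec_zero_iff c).1 (by rw [quad_eq]; exact z')
  have := congrFun this p
  simpa [mulVec, dotProduct] using this

open Polynomial in
lemma coeff_zero [DecidableEq ι] (e c : ι → ℝ) (N : ℕ) (hN : Fintype.card ι ≤ N) (p : ι)
    (h : ∀ k ≤ N, ∑ j, e j ^ k * c j = 0)
    (hp : ∀ j, j ≠ p → c j ≠ 0 → e j ≠ e p) : c p = 0 := by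
  set S : Finset ι := univ.filter fun j => j ≠ p ∧ c j ≠ 0 with hS
  set P : ℝ[X] := ∏ j ∈ S, (X - C (e j)) with hP
  have hdeg : P.natDegree ≤ N := by
    rw [hP, natDegree_prod_of_monic _ _ (fun j _ => monic_X_sub_C _)]
    simp only [natDegree_X_sub_C, sum_const, smul_eq_mul, mul_one]
    exact (Finset.card_le_univ S).trans hN
  have h0 : ∑ j, P.eval (e j) * c j = 0 := by
    simp only [eval_eq_sum_range, Finset.sum_mul]
    rw [Finset.sum_comm]
    refine Finset.sum_eq_zero fun k hk => ?_
    simp only [mul_assoc, ← Finset.mul_sum]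
    rw [h k (by simp at hk; omega), mul_zero]
  rw [Finset.sum_eq_single p] at h0
  · refine (mul_eq_zero.1 h0).resolve_left ?_
    rw [hP, eval_prod]
    refine Finset.prod_ne_zero_iff.2 fun j hj => ?_
    simp only [hS, mem_filter, mem_univ, true_and] at hj
    simpa [sub_eq_zero] using (hp j hj.1 hj.2).symm
  · intro j _ hj
    by_cases hc : c j = 0
    · simp [hc]
    · have : P.eval (e j) = 0 := by
        rw [hP, eval_prod]
        exact Finset.prod_eq_zero (i := j) (by simp [hS, hj, hc]) (by simp)
      simp [this]
  · simp

lemma semidef_all (A : Type*) [MetricSpace A] (t : ℕ → ℝ)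
    (htpos : ∀ k, 0 < t k) (ht0 : Filter.Tendsto t Filter.atTop (nhds 0))
    (hsemi : ∀ k, ∀ s : Finset A,
      (Matrix.of fun x y : ↥s => Real.exp (-(t k * dist (x : A) (y : A)))).PosSemidef)
    (u : ℝ) (hu : 0 < u) (s : Finset A) :
    (Matrix.of fun x y : ↥s => Real.exp (-(u * dist (x : A) (y : A)))).PosSemidef := by
  have hinv : Filter.Tendsto (fun k => (t k)⁻¹) Filter.atTop Filter.atTop :=
    Filter.Tendsto.inv_tendsto_nhdsGT_zero
      (tendsto_nhdsWithin_iff.2 ⟨ht0, Filter.Eventually.of_forall htpos⟩)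
  have hlim : Filter.Tendsto (fun k => (⌊u * (t k)⁻¹⌋₊ : ℝ) / (t k)⁻¹) Filter.atTop (nhds u) :=
    (tendsto_nat_floor_mul_div_atTop hu.le).comp hinv
  refine psd_of (fun i j => by simp [dist_comm]) fun x => ?_
  have hcont : Continuous fun v : ℝ => ∑ i : s, ∑ j : s,
      x i * Real.exp (-(v * dist (i : A) (j : A))) * x j := by fun_prop
  refine ge_of_tendsto ((hcont.tendsto u).comp hlim) (Filter.Eventually.of_forall fun k => ?_)
  have := psd_quad (psd_hpow (hsemi k s) ⌊u * (t k)⁻¹⌋₊) x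
  simp only [of_apply, ← Real.exp_nat_mul] at this
  simp only [Function.comp]
  refine this.trans_eq (Finset.sum_congr rfl fun i _ => Finset.sum_congr rfl fun j _ => ?_)
  congr 3
  rw [div_inv_eq_mul]; ring

end Aux12

theorem statement12 (A : Type*) [MetricSpace A] (t : ℕ → ℝ)
    (htpos : ∀ k, 0 < t k) (ht0 : Filter.Tendsto t Filter.atTop (nhds 0))
    (hsemi : ∀ k, ScaledPosSemidef A (t k)) :
    ∀ u : ℝ, 0 < u → ScaledPosDef A u := by
  classical
  intro u hu s
  have hall := Aux12.semidef_all A t htpos ht0 hsemi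
  have hU := hall u hu s
  refine Matrix.PosDef.of_dotProduct_mulVec_pos hU.isHermitian fun c hc => ?_
  refine lt_of_le_of_ne (hU.dotProduct_mulVec_nonneg c) fun h0 => ?_
  rw [Aux12.quad_eq] at h0
  obtain ⟨q, hq⟩ := Function.ne_iff.1 hc
  obtain ⟨p, hp, hmax⟩ := Finset.exists_max_image (Finset.univ.filter fun i => c i ≠ 0)
    (fun i : s => dist (i : A) (q : A)) ⟨q, by simpa using hq⟩
  simp only [Finset.mem_filter, Finset.mem_univ, true_and] at hp hmax
  set N : ℕ := Fintype.card s + 1 with hN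
  have hNpos : (0 : ℝ) < N := by rw [hN]; positivity
  set v : ℝ := u / N with hv
  have hvpos : 0 < v := div_pos hu hNpos
  have huv : u = N * v := by rw [hv]; field_simp
  have hE := Aux12.psd_shift (hall v hvpos s) q (by simp) (fun i => (Real.exp_pos _).ne')
  set E : Matrix s s ℝ := Matrix.of fun i j : s =>
    (Matrix.of fun x y : ↥s => Real.exp (-(v * dist (x : A) (y : A)))) i j /
      ((Matrix.of fun x y : ↥s => Real.exp (-(v * dist (x : A) (y : A)))) i q *
       (Matrix.of fun x y : ↥s => Real.exp (-(v * dist (x : A) (y : A)))) j q) - 1 with hEdef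
  have hEe : ∀ i j, E i j = Real.exp (v * (dist (i : A) q + dist (j : A) q - dist (i : A) j)) - 1 := by
    intro i j
    simp only [hEdef, Matrix.of_apply]
    rw [← Real.exp_add, ← Real.exp_sub]
    congr 2; ring
  set c' : s → ℝ := fun i => c i * Real.exp (-(u * dist (i : A) q)) with hc'
  have hz : ∑ i, ∑ j, c' i * (E i j + 1) ^ N * c' j = 0 := by
    rw [h0.symm.symm]
    refine Finset.sum_congr rfl fun i _ => Finset.sum_congr rfl fun j _ => ?_
    rw [hEe, sub_add_cancel, ← Real.exp_nat_mul]
    simp only [hc', Matrix.of_apply]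
    have : Real.exp (-(u * dist (i : A) j)) = Real.exp (-(u * dist (i : A) q)) *
        Real.exp (N * (v * (dist (i : A) q + dist (j : A) q - dist (i : A) j))) *
        Real.exp (-(u * dist (j : A) q)) := by
      rw [← Real.exp_add, ← Real.exp_add]
      congr 1
      rw [huv]; ring
    rw [this]; ring
  have hcp : c' p = 0 := by
    refine Aux12.coeff_zero (fun j => E p j) c' N (by omega) p
      (fun k hk => Aux12.row_zero hE N c' hz k hk p) fun j hj hcj => ?_
    have hcj' : c j ≠ 0 := fun h => hcj (by simp [hc', h])
    have h1 := hmax j hcj'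
    have h2 : 0 < dist (p : A) j := dist_pos.2 fun h => hj (Subtype.ext h.symm)
    refine ne_of_lt ?_
    simp only [hEe, dist_self]
    refine sub_lt_sub_right (Real.exp_lt_exp.2 (mul_lt_mul_of_pos_left ?_ hvpos)) 1
    linarith
  exact (mul_ne_zero hp (Real.exp_pos _).ne') hcp
end

section
/- A metric space (A,d) is stably positive definite if and only if it is of negative type; that is, (A, t·d) is positive definite for every t > 0 if and only if there exist a real Hilbert space H and a map φ : A → H such that ‖φ(x) − φ(y)‖² = d(x,y) for all x, y ∈ A. -/
universe u

/-- A metric space is of negative type if `(A, d^{1/2})` embeds isometrically into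
a real Hilbert space, i.e. there is `φ : A → H` with `‖φ x - φ y‖² = d(x,y)`. -/
def NegativeType (A : Type u) [MetricSpace A] : Prop :=
  ∃ (H : Type u) (_ : NormedAddCommGroup H) (_ : InnerProductSpace ℝ H)
    (_ : CompleteSpace H) (φ : A → H), ∀ x y : A, ‖φ x - φ y‖ ^ 2 = dist x y

open Matrix in
theorem exists_feature_map {X : Type u} (K : Matrix X X ℝ) (hK : K.PosSemidef) :
    ∃ (H : Type u) (_ : NormedAddCommGroup H) (_ : InnerProductSpace ℝ H)
      (_ : CompleteSpace H) (ψ : X → H), ∀ x y : X, inner ℝ (ψ x) (ψ y) = K x y := by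
  have hsymm : ∀ x y, K x y = K y x := fun x y => by
    simpa using (hK.isHermitian.apply x y).symm
  let K' : Matrix X X (ℝ →L[ℝ] ℝ) := Matrix.of fun x y => K x y • ContinuousLinearMap.id ℝ ℝ
  have hK' : K'.PosSemidef := by
    have htf := (RKHS.posSemidef_tfae (K := K')).out 0 2
    refine htf.mpr ⟨?_, fun v => ?_⟩
    · ext x y
      have hid : star (ContinuousLinearMap.id ℝ ℝ) = ContinuousLinearMap.id ℝ ℝ :=
        star_one (ℝ →L[ℝ] ℝ)
      simp [K', Matrix.conjTranspose_apply, hsymm x y, hid]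
    · have h := hK.2 v
      simp only [K', Matrix.of_apply]
      refine h.trans_eq ?_
      simp only [Finsupp.sum, RCLike.re_to_real]
      refine Finset.sum_congr rfl fun i _ => Finset.sum_congr rfl fun j _ => ?_
      simp [hsymm i j]
      ring
  have : Fact K'.PosSemidef := ⟨hK'⟩
  refine ⟨RKHS.OfKernel K', inferInstance, inferInstance, inferInstance,
    fun x => RKHS.kerFun (RKHS.OfKernel K') x 1, fun x y => ?_⟩
  rw [← RKHS.kernel_inner, RKHS.OfKernel.kernel_ofKernel]
  simp [K', hsymm x y]

theorem posSemidef_exp {X : Type*} (K : Matrix X X ℝ) (hK : K.PosSemidef) :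
    (Matrix.of fun x y => Real.exp (K x y)).PosSemidef := by
  have hpow : ∀ n : ℕ, (Matrix.of fun x y => (K x y) ^ n : Matrix X X ℝ).PosSemidef := by
    intro n
    induction n with
    | zero =>
      refine ⟨by ext; simp, fun c => ?_⟩
      have : (c.sum fun i xi => c.sum fun j xj => star xi *
        (Matrix.of fun x y => (K x y) ^ 0 : Matrix X X ℝ) i j * xj) =
          (∑ i ∈ c.support, c i) * (∑ i ∈ c.support, c i) := by
        simp [Finsupp.sum, Finset.sum_mul_sum]
      rw [this]
      exact mul_self_nonneg _
    | succ n ih =>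
      have h := ih.hadamard hK
      have e : (Matrix.of fun x y => (K x y) ^ (n + 1) : Matrix X X ℝ) =
          (Matrix.of fun x y => (K x y) ^ n : Matrix X X ℝ).hadamard K := by
        ext x y
        simp [pow_succ]
      rw [e]
      exact h
  refine ⟨?_, fun c => ?_⟩
  · ext x y
    have := hK.isHermitian.apply x y
    simp at this
    simp [this]
  · have hs : HasSum (fun n : ℕ => ∑ i ∈ c.support, ∑ j ∈ c.support,
        c i * ((K i j) ^ n / n.factorial) * c j)
        (∑ i ∈ c.support, ∑ j ∈ c.support, c i * Real.exp (K i j) * c j) := by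
      refine hasSum_sum fun i _ => hasSum_sum fun j _ => ?_
      refine HasSum.mul_right _ (HasSum.mul_left _ ?_)
      rw [Real.exp_eq_exp_ℝ]
      exact NormedSpace.expSeries_div_hasSum_exp (K i j)
    simp only [Finsupp.sum, Matrix.of_apply, star_trivial]
    refine hs.nonneg fun n => ?_
    have h := (hpow n).2 c
    simp only [Finsupp.sum, Matrix.of_apply, star_trivial] at h
    have h2 : ∑ i ∈ c.support, ∑ j ∈ c.support, c i * ((K i j) ^ n / n.factorial) * c j =
        (∑ i ∈ c.support, ∑ j ∈ c.support, c i * (K i j) ^ n * c j) / n.factorial := by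
      simp only [Finset.sum_div]
      refine Finset.sum_congr rfl fun i _ => Finset.sum_congr rfl fun j _ => ?_
      ring
    rw [h2]
    positivity

theorem linearIndependent_exp_inner {H : Type*} [NormedAddCommGroup H] [InnerProductSpace ℝ H]
    {ι : Type*} (p : ι → H) (hp : Function.Injective p) (c : ℝ) (hc : c ≠ 0) :
    LinearIndependent ℝ (fun i => (fun u : H => Real.exp (c * inner ℝ (p i) u))) := by
  let f : ι → (Multiplicative H →* ℝ) := fun i =>
    { toFun := fun u => Real.exp (c * inner ℝ (p i) (Multiplicative.toAdd u))
      map_one' := by simp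
      map_mul' := fun u v => by simp [inner_add_right, mul_add, Real.exp_add] }
  have hf : Function.Injective f := by
    intro i j hij
    apply hp
    refine ext_inner_right ℝ fun u => ?_
    have := DFunLike.congr_fun hij (Multiplicative.ofAdd u)
    simpa [f, hc] using this
  exact (linearIndependent_monoidHom (Multiplicative H) ℝ).comp f hf

theorem scaledPosDef_of_negativeType (A : Type u) [MetricSpace A] (h : NegativeType A)
    (t : ℝ) (ht : 0 < t) : ScaledPosDef A t := by
  obtain ⟨H, _, _, _, φ, hφ⟩ := h
  intro s
  have hinj : Function.Injective φ := fun x y hxy => by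
    have := hφ x y
    rw [hxy, sub_self, norm_zero] at this
    exact dist_eq_zero.mp (by rw [← this]; norm_num)
  have hK : (Matrix.of fun x y : H => (2 * t) * inner ℝ x y : Matrix H H ℝ).PosSemidef := by
    refine ⟨?_, fun c => ?_⟩
    · ext x y
      simp [real_inner_comm]
    · have e : (c.sum fun i xi => c.sum fun j xj => star xi *
          (Matrix.of fun x y : H => (2 * t) * inner ℝ x y : Matrix H H ℝ) i j * xj) =
          2 * t * inner ℝ (∑ i ∈ c.support, c i • i) (∑ i ∈ c.support, c i • i) := by
        simp only [Finsupp.sum, Matrix.of_apply, star_trivial, sum_inner, inner_sum,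
          inner_smul_left, inner_smul_right, conj_trivial, Finset.mul_sum]
        refine Finset.sum_congr rfl fun i _ => Finset.sum_congr rfl fun j _ => ?_
        rw [real_inner_comm]
        ring
      rw [e]
      exact mul_nonneg (by positivity) real_inner_self_nonneg
  obtain ⟨H', _, _, _, ψ, hψ⟩ := exists_feature_map _ (posSemidef_exp _ hK)
  simp only [Matrix.of_apply] at hψ
  have hli : LinearIndependent ℝ
      (fun i : ↥s => Real.exp (-(t * ‖φ i‖ ^ 2)) • ψ (φ i)) := by
    rw [Fintype.linearIndependent_iff]
    intro g hg i
    have h1 := linearIndependent_exp_inner (fun i : ↥s => φ i)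
      (hinj.comp Subtype.val_injective) (2 * t) (by positivity)
    rw [Fintype.linearIndependent_iff] at h1
    have h2 := h1 (fun i => g i * Real.exp (-(t * ‖φ i‖ ^ 2))) (by
      ext u
      have := congrArg (fun z => inner ℝ z (ψ u)) hg
      simp only [sum_inner, inner_smul_left, hψ, inner_zero_left] at this
      simpa [mul_assoc] using this) i
    simpa using h2
  have := Matrix.posDef_gram_of_linearIndependent hli
  suffices e : (Matrix.of fun x y : ↥s => Real.exp (-(t * dist (x : A) (y : A)))) =
      Matrix.gram ℝ (fun i : ↥s => Real.exp (-(t * ‖φ i‖ ^ 2)) • ψ (φ i)) by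
    rw [e]
    exact this
  ext x y
  rw [Matrix.gram_apply, inner_smul_left, inner_smul_right, hψ]
  simp only [Matrix.of_apply, conj_trivial, ← Real.exp_add]
  rw [← hφ, norm_sub_sq_real]
  congr 1
  ring

theorem neg_type_ineq (A : Type u) [MetricSpace A] (h : ∀ t : ℝ, 0 < t → ScaledPosDef A t)
    (s : Finset A) (c : A → ℝ) (hc : ∑ x ∈ s, c x = 0) :
    ∑ x ∈ s, ∑ y ∈ s, c x * dist x y * c y ≤ 0 := by
  let f : ℝ → ℝ := fun t => ∑ x ∈ s, ∑ y ∈ s, c x * Real.exp (-(t * dist x y)) * c y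
  have hf : HasDerivAt f (∑ x ∈ s, ∑ y ∈ s, c x * (-dist x y) * c y) 0 := by
    refine HasDerivAt.fun_sum fun x _ => HasDerivAt.fun_sum fun y _ => ?_
    refine HasDerivAt.mul_const (HasDerivAt.const_mul _ ?_) _
    have := (((hasDerivAt_id (0 : ℝ)).mul_const (dist x y)).neg).exp
    simpa using this
  have hf0 : f 0 = 0 := by
    simp [f, ← Finset.mul_sum, hc]
  have hpos : ∀ t > 0, 0 ≤ f t := by
    intro t ht
    have h1 := (h t ht s).posSemidef.dotProduct_mulVec_nonneg (fun x : ↥s => c x)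
    refine h1.trans_eq ?_
    simp only [f]
    rw [← Finset.sum_coe_sort s]
    simp only [dotProduct, Matrix.mulVec, Finset.mul_sum, Matrix.of_apply]
    refine Finset.sum_congr rfl fun x _ => ?_
    rw [← Finset.sum_coe_sort s]
    refine Finset.sum_congr rfl fun y _ => ?_
    simp [mul_assoc]
  have hlim : Filter.Tendsto (fun t : ℝ => t⁻¹ • (f (0 + t) - f 0)) (nhdsWithin 0 (Set.Ioi 0))
      (nhds (∑ x ∈ s, ∑ y ∈ s, c x * (-dist x y) * c y)) :=
    hf.tendsto_slope_zero_right
  have := ge_of_tendsto hlim (b := 0) (by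
    filter_upwards [self_mem_nhdsWithin] with t ht
    have ht' : (0 : ℝ) < t := ht
    have := hpos t ht'
    simp only [zero_add, hf0, sub_zero, smul_eq_mul]
    positivity)
  simp only [mul_neg, neg_mul, Finset.sum_neg_distrib] at this
  linarith

theorem negativeType_of_scaledPosDef (A : Type u) [MetricSpace A]
    (h : ∀ t : ℝ, 0 < t → ScaledPosDef A t) : NegativeType A := by
  classical
  rcases isEmpty_or_nonempty A with hA | ⟨⟨a⟩⟩
  · exact ⟨PUnit, inferInstance, inferInstance, inferInstance, fun _ => 0, fun x => hA.elim x⟩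
  have hK : (Matrix.of fun x y : A => (dist x a + dist y a - dist x y) / 2 :
      Matrix A A ℝ).PosSemidef := by
    refine ⟨?_, fun c => ?_⟩
    · ext x y
      simp [dist_comm x y, add_comm]
    · simp only [Finsupp.sum, Matrix.of_apply, star_trivial]
      let s := insert a c.support
      have hsub : c.support ⊆ s := Finset.subset_insert _ _
      have e1 : ∑ x ∈ c.support, ∑ y ∈ c.support,
          c x * ((dist x a + dist y a - dist x y) / 2) * c y =
          ∑ x ∈ s, ∑ y ∈ s, c x * ((dist x a + dist y a - dist x y) / 2) * c y := by
        rw [Finset.sum_subset hsub (fun x _ hx => by simp [Finsupp.notMem_support_iff.mp hx])]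
        refine Finset.sum_congr rfl fun x _ => ?_
        rw [Finset.sum_subset hsub (fun x _ hx => by simp [Finsupp.notMem_support_iff.mp hx])]
      rw [e1]
      have ha : a ∈ s := Finset.mem_insert_self _ _
      set S := ∑ x ∈ s, c x with hS
      have h1 := neg_type_ineq A h s (fun x => c x - if x = a then S else 0) (by
        simp [Finset.sum_sub_distrib, ha, hS])
      have e2 : ∑ x ∈ s, ∑ y ∈ s, (c x - if x = a then S else 0) * dist x y *
          (c y - if y = a then S else 0) =
          ∑ x ∈ s, ∑ y ∈ s, c x * dist x y * c y - 2 * S * ∑ x ∈ s, c x * dist x a := by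
        have : ∀ x ∈ s, ∑ y ∈ s, (c x - if x = a then S else 0) * dist x y *
          (c y - if y = a then S else 0) = (∑ y ∈ s, c x * dist x y * c y) - c x * dist x a * S
            - (if x = a then S * ∑ y ∈ s, c y * dist y a else 0) := by
          intro x _
          simp only [mul_sub, sub_mul, Finset.sum_sub_distrib, mul_ite, ite_mul, mul_zero, zero_mul,
            Finset.sum_ite_eq', ha, if_true]
          split_ifs with hx
          · subst hx
            have e4 : ∑ y ∈ s, S * dist x y * c y = S * ∑ y ∈ s, c y * dist y x := by
              rw [Finset.mul_sum]
              refine Finset.sum_congr rfl fun y _ => ?_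
              rw [dist_comm y x]
              ring
            simp [e4]
          · simp
        rw [Finset.sum_congr rfl this]
        simp only [Finset.sum_sub_distrib, Finset.sum_ite_eq', ha, if_true, ← Finset.sum_mul]
        ring
      have e3 : ∑ x ∈ s, ∑ y ∈ s, c x * ((dist x a + dist y a - dist x y) / 2) * c y =
          S * (∑ x ∈ s, c x * dist x a) - (∑ x ∈ s, ∑ y ∈ s, c x * dist x y * c y) / 2 := by
        have : ∀ x ∈ s, ∑ y ∈ s, c x * ((dist x a + dist y a - dist x y) / 2) * c y =
            c x * dist x a * S / 2 + c x * (∑ y ∈ s, c y * dist y a) / 2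
              - (∑ y ∈ s, c x * dist x y * c y) / 2 := by
          intro x _
          rw [hS]
          simp only [Finset.mul_sum, Finset.sum_div, ← Finset.sum_add_distrib,
            ← Finset.sum_sub_distrib]
          refine Finset.sum_congr rfl fun y _ => ?_
          ring
        rw [Finset.sum_congr rfl this]
        simp only [Finset.sum_sub_distrib, Finset.sum_add_distrib, ← Finset.sum_div,
          ← Finset.sum_mul, ← hS]
        ring
      rw [e2] at h1
      rw [e3]
      linarith
  obtain ⟨H, i1, i2, i3, ψ, hψ⟩ := exists_feature_map _ hK
  refine ⟨H, i1, i2, i3, ψ, fun x y => ?_⟩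
  rw [norm_sub_sq_real, ← real_inner_self_eq_norm_sq, ← real_inner_self_eq_norm_sq, hψ, hψ, hψ]
  simp
  ring

theorem statement13 (A : Type u) [MetricSpace A] :
    (∀ t : ℝ, 0 < t → ScaledPosDef A t) ↔ NegativeType A :=
  ⟨negativeType_of_scaledPosDef A, scaledPosDef_of_negativeType A⟩
end
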